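/- Let R be a Noetherian local ring which is the homomorphic image of a Cohen-Macaulay ring, I an ideal of R, and M a finitely generated R-module of dimension n with r = dim M/IM. Suppose M is equidimensional and satisfies Serre's condition S_ℓ for some ℓ ≤ n - r - 1. Then H^i_I(M) is a finitely generated R-module for all i < ℓ + 1. -/

import Mathlib

open CategoryTheory

noncomputable section

universe u

/-- The Krull dimension of a module: `dim R/ann(M)`. -/
def moduleDim (R : Type u) [CommRing R] (M : Type*) [AddCommGroup M] [Module R M] :
    WithBot (WithTop ℕ) :=
  ringKrullDim (R ⧸ Module.annihilator R M)

/-- The depth of `M` with respect to an ideal `J`: the supremum of the lengths of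
`M`-regular sequences consisting of elements of `J`. -/
def moduleDepth (R : Type u) [CommRing R] (J : Ideal R) (M : Type*) [AddCommGroup M]
    [Module R M] : ℕ∞ :=
  sSup {n : ℕ∞ | ∃ rs : List R, (rs.length : ℕ∞) = n ∧ (∀ r ∈ rs, r ∈ J) ∧
    RingTheory.Sequence.IsRegular M rs}

/-- Serre's condition `S_ℓ` : for every prime `p` in the support of `M`,
`depth M_p ≥ min (ℓ, dim M_p)`. -/
def SerreCondition (R : Type u) [CommRing R] (ℓ : ℕ) (M : Type u) [AddCommGroup M]
    [Module R M] : Prop :=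
  ∀ p ∈ Module.support R M,
    min ((ℓ : ℕ∞) : WithBot ℕ∞)
        (moduleDim (Localization.AtPrime p.asIdeal) (LocalizedModule p.asIdeal.primeCompl M)) ≤
      ((moduleDepth (Localization.AtPrime p.asIdeal)
          (IsLocalRing.maximalIdeal (Localization.AtPrime p.asIdeal))
          (LocalizedModule p.asIdeal.primeCompl M) : ℕ∞) : WithBot ℕ∞)

/-- A module `N` over `S` is `J`-cofinite if its support is contained in `V(J)` and all the
modules `Ext^i_S(S/J, N)` are finitely generated. -/
def IsCofinite (S : Type u) [CommRing S] (J : Ideal S) (N : ModuleCat.{u} S) : Prop :=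
  Module.support S N ⊆ PrimeSpectrum.zeroLocus (J : Set S) ∧
  ∀ i : ℕ, Module.Finite S
    (((Ext S (ModuleCat.{u} S) i).obj (Opposite.op (ModuleCat.of S (S ⧸ J)))).obj N)

/-- A ring is catenary if any two saturated chains of primes with the same endpoints have
the same length. -/
def IsCatenaryRing (R : Type u) [CommRing R] : Prop :=
  ∀ c₁ c₂ : LTSeries (PrimeSpectrum R),
    c₁.head = c₂.head → c₁.last = c₂.last →
    (∀ i : Fin c₁.length, c₁.toFun i.castSucc ⋖ c₁.toFun i.succ) →
    (∀ i : Fin c₂.length, c₂.toFun i.castSucc ⋖ c₂.toFun i.succ) →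
    c₁.length = c₂.length

/-- A module is indecomposable if it is nonzero and is not the internal direct sum of two
nonzero submodules. -/
def ModuleIndecomposable (R : Type u) [CommRing R] (M : Type*) [AddCommGroup M]
    [Module R M] : Prop :=
  Nontrivial M ∧ ∀ N₁ N₂ : Submodule R M, IsCompl N₁ N₂ → N₁ = ⊥ ∨ N₂ = ⊥

/-- A module is equidimensional if `dim R/P = dim M` for every minimal prime `P`
of its support (equivalently, of its annihilator). -/
def Equidimensional (R : Type u) [CommRing R] (M : Type*) [AddCommGroup M]
    [Module R M] : Prop :=
  ∀ P ∈ (Module.annihilator R M).minimalPrimes, ringKrullDim (R ⧸ P) = moduleDim R M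

/-- A local ring is Cohen-Macaulay if its depth equals its Krull dimension. -/
def IsCMLocalRing (S : Type u) [CommRing S] [IsLocalRing S] : Prop :=
  ((moduleDepth S (IsLocalRing.maximalIdeal S) S : ℕ∞) : WithBot ℕ∞) = ringKrullDim S

/-- A ring is Cohen-Macaulay if all its localizations at primes are Cohen-Macaulay local
rings. -/
def IsCMRing (S : Type u) [CommRing S] : Prop :=
  ∀ p : PrimeSpectrum S, IsCMLocalRing (Localization.AtPrime p.asIdeal)

section OpComplex

open Opposite

variable {R : Type u} [CommRing R] (K : ChainComplex (ModuleCat.{u} R)ᵒᵖ ℕ)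

/-- `φ` is a cocycle of `K` in degree `n` whose class is `e`. -/
def RepresentsHomology (n : ℕ) (φ : (K.X n).unop) (e : (K.homology n).unop) : Prop :=
  ∃ z : (K.opcycles n).unop, (K.homologyι n).unop z = e ∧ (K.pOpcycles n).unop z = φ

variable {K}

lemma RepresentsHomology.add {n : ℕ} {φ φ' : (K.X n).unop} {e e' : (K.homology n).unop}
    (h : RepresentsHomology K n φ e) (h' : RepresentsHomology K n φ' e') :
    RepresentsHomology K n (φ + φ') (e + e') := by
  obtain ⟨z, rfl, rfl⟩ := h
  obtain ⟨z', rfl, rfl⟩ := h'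
  exact ⟨z + z', map_add _ _ _, map_add _ _ _⟩

lemma RepresentsHomology.smul {n : ℕ} {φ : (K.X n).unop} {e : (K.homology n).unop}
    (h : RepresentsHomology K n φ e) (s : R) :
    RepresentsHomology K n (s • φ) (s • e) := by
  obtain ⟨z, rfl, rfl⟩ := h
  exact ⟨s • z, map_smul _ _ _, map_smul _ _ _⟩

lemma RepresentsHomology.exists_left {n : ℕ} (e : (K.homology n).unop) :
    ∃ φ, RepresentsHomology K n φ e := by
  obtain ⟨z, hz⟩ := (ModuleCat.epi_iff_surjective (K.homologyι n).unop).1 inferInstance e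
  exact ⟨_, z, hz, rfl⟩

lemma RepresentsHomology.cocycle {n : ℕ} {φ : (K.X n).unop} {e : (K.homology n).unop}
    (h : RepresentsHomology K n φ e) : (K.d (n + 1) n).unop φ = 0 := by
  obtain ⟨z, rfl, rfl⟩ := h
  have := congr_arg Quiver.Hom.unop (K.d_pOpcycles (n + 1) n)
  rw [unop_comp] at this
  exact congr($this z)

lemma RepresentsHomology.exists_right {n : ℕ} (φ : (K.X n).unop)
    (h : (K.d (n + 1) n).unop φ = 0) : ∃ e, RepresentsHomology K n φ e := by
  have hex : (ShortComplex.mk _ _ (K.d_pOpcycles (n + 1) n)).Exact :=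
    ShortComplex.exact_of_g_is_cokernel _ (K.opcyclesIsCokernel (n + 1) n (by simp))
  have h2 := (ShortComplex.moduleCat_exact_iff _).1 hex.unop φ h
  obtain ⟨z, hz⟩ := h2
  exact ⟨_, z, rfl, hz⟩

lemma RepresentsHomology.eq_zero_iff {n : ℕ} {φ : (K.X n).unop} {e : (K.homology n).unop}
    (h : RepresentsHomology K n φ e) :
    e = 0 ↔ ∃ w : (K.X (n - 1)).unop, (K.d n (n - 1)).unop w = φ := by
  obtain ⟨z, rfl, rfl⟩ := h
  have hn : (ComplexShape.down ℕ).next n = n - 1 := by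
    cases n with
    | zero => simp
    | succ n => simp
  have hex : (ShortComplex.mk _ _ (K.homologyι_comp_fromOpcycles n (n - 1))).Exact :=
    ShortComplex.exact_of_f_is_kernel _ (K.homologyIsKernel n (n - 1) hn)
  have hd := congr_arg Quiver.Hom.unop (K.p_fromOpcycles n (n - 1))
  rw [unop_comp] at hd
  have hinj : Function.Injective (K.pOpcycles n).unop :=
    (ModuleCat.mono_iff_injective _).1 inferInstance
  constructor
  · intro h
    obtain ⟨w, hw⟩ := (ShortComplex.moduleCat_exact_iff _).1 hex.unop z h
    refine ⟨w, ?_⟩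
    rw [← hd]
    exact congr_arg _ hw
  · rintro ⟨w, hw⟩
    have hz : (K.fromOpcycles n (n - 1)).unop w = z := by
      apply hinj
      rw [← hw, ← hd]
      rfl
    have h0 := congr_arg Quiver.Hom.unop (K.homologyι_comp_fromOpcycles n (n - 1))
    rw [unop_comp] at h0
    rw [← hz]
    exact congr($h0 w)

lemma RepresentsHomology.map {L : ChainComplex (ModuleCat.{u} R)ᵒᵖ ℕ} (g : K ⟶ L) {n : ℕ}
    {φ : (L.X n).unop} {e : (L.homology n).unop} (h : RepresentsHomology L n φ e) :
    RepresentsHomology K n ((g.f n).unop φ) ((HomologicalComplex.homologyMap g n).unop e) := by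
  obtain ⟨z, rfl, rfl⟩ := h
  have h1 := congr_arg Quiver.Hom.unop (HomologicalComplex.homologyι_naturality g n)
  have h2 := congr_arg Quiver.Hom.unop (HomologicalComplex.p_opcyclesMap g n)
  rw [unop_comp, unop_comp] at h1 h2
  exact ⟨(HomologicalComplex.opcyclesMap g n).unop z, congr($h1 z).symm, congr($h2 z)⟩

end OpComplex

section ExtClasses

open Opposite

variable {R : Type u} [CommRing R]

/-- The complex computing `Ext`, as a complex in the opposite category. -/
abbrev extComplex {X : ModuleCat.{u} R} (P : ProjectiveResolution X) (Y : ModuleCat.{u} R) :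
    ChainComplex (ModuleCat.{u} R)ᵒᵖ ℕ :=
  ((((linearYoneda R (ModuleCat.{u} R)).obj Y).rightOp).mapHomologicalComplex _).obj P.complex

/-- The class of the cocycle `φ` is `e`. -/
def RepresentsExt {X : ModuleCat.{u} R} (P : ProjectiveResolution X) (n : ℕ)
    {Y : ModuleCat.{u} R} (φ : P.complex.X n ⟶ Y)
    (e : ((Ext R (ModuleCat.{u} R) n).obj (op X)).obj Y) : Prop :=
  ∃ e' : ((extComplex P Y).homology n).unop,
    (P.isoLeftDerivedObj ((linearYoneda R (ModuleCat.{u} R)).obj Y).rightOp n).hom.unop e' = e ∧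
    RepresentsHomology (extComplex P Y) n φ e'

namespace RepresentsExt

variable {X : ModuleCat.{u} R} {P : ProjectiveResolution X} {n : ℕ} {Y : ModuleCat.{u} R}

lemma add {φ φ' : P.complex.X n ⟶ Y} {e e' : ((Ext R (ModuleCat.{u} R) n).obj (op X)).obj Y}
    (h : RepresentsExt P n φ e) (h' : RepresentsExt P n φ' e') :
    RepresentsExt P n (φ + φ') (e + e') := by
  obtain ⟨e, rfl, h⟩ := h
  obtain ⟨e', rfl, h'⟩ := h'
  exact ⟨e + e', map_add _ _ _, h.add h'⟩

lemma smul {φ : P.complex.X n ⟶ Y} {e : ((Ext R (ModuleCat.{u} R) n).obj (op X)).obj Y}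
    (h : RepresentsExt P n φ e) (s : R) :
    RepresentsExt P n (s • φ) (s • e) := by
  obtain ⟨e, rfl, h⟩ := h
  exact ⟨s • e, map_smul _ _ _, h.smul s⟩

lemma exists_left (P : ProjectiveResolution X)
    (e : ((Ext R (ModuleCat.{u} R) n).obj (op X)).obj Y) :
    ∃ φ, RepresentsExt P n φ e := by
  obtain ⟨e', he⟩ := (ModuleCat.epi_iff_surjective (P.isoLeftDerivedObj
    ((linearYoneda R (ModuleCat.{u} R)).obj Y).rightOp n).hom.unop).1 inferInstance e
  obtain ⟨φ, hφ⟩ := RepresentsHomology.exists_left (K := extComplex P Y) e'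
  exact ⟨φ, e', he, hφ⟩

lemma cocycle {φ : P.complex.X n ⟶ Y} {e : ((Ext R (ModuleCat.{u} R) n).obj (op X)).obj Y}
    (h : RepresentsExt P n φ e) : P.complex.d (n + 1) n ≫ φ = 0 := by
  obtain ⟨e, rfl, h⟩ := h
  exact h.cocycle

lemma exists_right (φ : P.complex.X n ⟶ Y) (h : P.complex.d (n + 1) n ≫ φ = 0) :
    ∃ e, RepresentsExt P n φ e := by
  obtain ⟨e, he⟩ := RepresentsHomology.exists_right (K := extComplex P Y) φ h
  exact ⟨_, e, rfl, he⟩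

lemma eq_zero_iff {φ : P.complex.X n ⟶ Y}
    {e : ((Ext R (ModuleCat.{u} R) n).obj (op X)).obj Y} (h : RepresentsExt P n φ e) :
    e = 0 ↔ ∃ w : P.complex.X (n - 1) ⟶ Y, P.complex.d n (n - 1) ≫ w = φ := by
  obtain ⟨e, rfl, h⟩ := h
  have hinj := (ModuleCat.mono_iff_injective (P.isoLeftDerivedObj
    ((linearYoneda R (ModuleCat.{u} R)).obj Y).rightOp n).hom.unop).1 inferInstance
  exact (map_eq_zero_iff _ hinj).trans h.eq_zero_iff

lemma map_right {Z : ModuleCat.{u} R} (g : Y ⟶ Z) {φ : P.complex.X n ⟶ Y}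
    {e : ((Ext R (ModuleCat.{u} R) n).obj (op X)).obj Y} (h : RepresentsExt P n φ e) :
    RepresentsExt P n (φ ≫ g) (((Ext R (ModuleCat.{u} R) n).obj (op X)).map g e) := by
  obtain ⟨e, rfl, h⟩ := h
  refine ⟨_, ?_, h.map ((NatTrans.mapHomologicalComplex
    (NatTrans.rightOp ((linearYoneda R (ModuleCat.{u} R)).map g)) _).app P.complex)⟩
  have := P.leftDerived_app_eq
    (NatTrans.rightOp ((linearYoneda R (ModuleCat.{u} R)).map g)) n
  have h2 := congr_arg (fun f => Quiver.Hom.unop (f ≫ (P.isoLeftDerivedObj _ n).hom)) this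
  simp only [Category.assoc, Iso.inv_hom_id, Category.comp_id] at h2
  rw [unop_comp, unop_comp] at h2
  exact congr($h2 e).symm

lemma map_left {X' : ModuleCat.{u} R} (f : X' ⟶ X) {P' : ProjectiveResolution X'}
    (l : P'.complex ⟶ P.complex) (hl : l.f 0 ≫ P.π.f 0 = P'.π.f 0 ≫ f)
    {φ : P.complex.X n ⟶ Y}
    {e : ((Ext R (ModuleCat.{u} R) n).obj (op X)).obj Y} (h : RepresentsExt P n φ e) :
    RepresentsExt P' n (l.f n ≫ φ) (((Ext R (ModuleCat.{u} R) n).map f.op).app Y e) := by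
  obtain ⟨e, rfl, h⟩ := h
  refine ⟨_, ?_, h.map (((((linearYoneda R (ModuleCat.{u} R)).obj Y).rightOp).mapHomologicalComplex
    _).map l)⟩
  have h2 := congr_arg Quiver.Hom.unop (ProjectiveResolution.isoLeftDerivedObj_hom_naturality f P' P
    l hl ((linearYoneda R (ModuleCat.{u} R)).obj Y).rightOp n)
  rw [unop_comp, unop_comp] at h2
  exact congr($h2 e).symm

end RepresentsExt

end ExtClasses

section LocalCohomologyClasses

open Opposite Limits

variable {R : Type u} [CommRing R] (I : Ideal R)

/-- A projective resolution of `R ⧸ I ^ t`. -/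
abbrev powRes (t : ℕ) : ProjectiveResolution (ModuleCat.of R (R ⧸ I ^ t)) :=
  projectiveResolution _

/-- The projection `R ⧸ I ^ t' → R ⧸ I ^ t`. -/
def powProj {t t' : ℕ} (h : t ≤ t') :
    ModuleCat.of R (R ⧸ I ^ t') ⟶ ModuleCat.of R (R ⧸ I ^ t) :=
  ModuleCat.ofHom (Submodule.mapQ _ _ LinearMap.id (Ideal.pow_le_pow_right h))

/-- A lift of `powProj` to the resolutions. -/
def powLift {t t' : ℕ} (h : t ≤ t') : (powRes I t').complex ⟶ (powRes I t).complex :=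
  ProjectiveResolution.lift (powProj I h) _ _

lemma powLift_comm {t t' : ℕ} (h : t ≤ t') :
    (powLift I h).f 0 ≫ (powRes I t).π.f 0 = (powRes I t').π.f 0 ≫ powProj I h :=
  ProjectiveResolution.lift_commutes_zero _ _ _

variable {I}

/-- The canonical map from `Ext` to local cohomology. -/
def extToLocalCohomology (t n : ℕ) (Y : ModuleCat.{u} R) :
    ((Ext R (ModuleCat.{u} R) n).obj (op (ModuleCat.of R (R ⧸ I ^ t)))).obj Y ⟶
      (localCohomology I n).obj Y :=
  (colimit.ι (localCohomology.diagram (localCohomology.idealPowersDiagram I) n)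
    (op (op t))).app Y

lemma extToLocalCohomology_map_left {t t' : ℕ} (h : t ≤ t') (n : ℕ) (Y : ModuleCat.{u} R) :
    ((Ext R (ModuleCat.{u} R) n).map (powProj I h).op).app Y ≫ extToLocalCohomology t' n Y =
      extToLocalCohomology t n Y := by
  have := colimit.w (localCohomology.diagram (localCohomology.idealPowersDiagram I) n)
    (homOfLE h).op.op
  exact congr_arg (fun f => NatTrans.app f Y) this

lemma extToLocalCohomology_map_right {Y Z : ModuleCat.{u} R} (g : Y ⟶ Z) (t n : ℕ) :
    ((Ext R (ModuleCat.{u} R) n).obj (op (ModuleCat.of R (R ⧸ I ^ t)))).map g ≫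
      extToLocalCohomology t n Z = extToLocalCohomology t n Y ≫ (localCohomology I n).map g :=
  (colimit.ι (localCohomology.diagram (localCohomology.idealPowersDiagram I) n)
    (op (op t))).naturality g

variable (I) in
/-- The colimit defining local cohomology, evaluated at a module. -/
def localCohomologyIsColimit (n : ℕ) (Y : ModuleCat.{u} R) :
    IsColimit (((evaluation _ _).obj Y).mapCocone (colimit.cocone
      (localCohomology.diagram (localCohomology.idealPowersDiagram I) n))) :=
  isColimitOfPreserves ((evaluation _ _).obj Y)
    (colimit.isColimit (localCohomology.diagram (localCohomology.idealPowersDiagram I) n))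

lemma preservesColimitsOfShape_forget_op_op_nat :
    PreservesColimitsOfShape ℕᵒᵖᵒᵖ (forget (ModuleCat.{u} R)) :=
  have : PreservesFilteredColimitsOfSize.{0, 0} (forget (ModuleCat.{u} R)) :=
    preservesFilteredColimitsOfSize_shrink.{0, u, 0, u} _
  PreservesFilteredColimitsOfSize.preserves_filtered_colimits.{0, 0} ℕᵒᵖᵒᵖ

lemma exists_extToLocalCohomology_eq {n : ℕ} {Y : ModuleCat.{u} R}
    (h : (localCohomology I n).obj Y) : ∃ t e, extToLocalCohomology t n Y e = h := by
  have := preservesColimitsOfShape_forget_op_op_nat (R := R)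
  obtain ⟨⟨⟨t⟩⟩, e, he⟩ := Concrete.isColimit_exists_rep _ (localCohomologyIsColimit I n Y) h
  exact ⟨t, e, he⟩

lemma extToLocalCohomology_eq_zero {t n : ℕ} {Y : ModuleCat.{u} R}
    (e : ((Ext R (ModuleCat.{u} R) n).obj (op (ModuleCat.of R (R ⧸ I ^ t)))).obj Y)
    (h : extToLocalCohomology t n Y e = 0) :
    ∃ (t' : ℕ) (h : t ≤ t'), ((Ext R (ModuleCat.{u} R) n).map (powProj I h).op).app Y e = 0 := by
  have := preservesColimitsOfShape_forget_op_op_nat (R := R)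
  obtain ⟨⟨⟨t'⟩⟩, f, g, hfg⟩ := Concrete.isColimit_exists_of_rep_eq _
    (localCohomologyIsColimit I n Y) (i := op (op t)) (j := op (op t)) e
    (0 : ((Ext R (ModuleCat.{u} R) n).obj (op (ModuleCat.of R (R ⧸ I ^ t)))).obj Y)
    (h.trans (map_zero _).symm)
  exact ⟨t', leOfHom f.unop.unop, hfg.trans (map_zero _)⟩

/-- `φ` is a cocycle of degree `n` whose class in local cohomology is `h`. -/
def RepresentsLC (t n : ℕ) {Y : ModuleCat.{u} R} (φ : (powRes I t).complex.X n ⟶ Y)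
    (h : (localCohomology I n).obj Y) : Prop :=
  ∃ e, RepresentsExt (powRes I t) n φ e ∧ extToLocalCohomology t n Y e = h

namespace RepresentsLC

variable {t n : ℕ} {Y : ModuleCat.{u} R}

lemma add {φ φ' : (powRes I t).complex.X n ⟶ Y} {h h' : (localCohomology I n).obj Y}
    (H : RepresentsLC t n φ h) (H' : RepresentsLC t n φ' h') :
    RepresentsLC t n (φ + φ') (h + h') := by
  obtain ⟨e, he, rfl⟩ := H
  obtain ⟨e', he', rfl⟩ := H'
  exact ⟨_, he.add he', map_add _ _ _⟩

lemma smul {φ : (powRes I t).complex.X n ⟶ Y} {h : (localCohomology I n).obj Y}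
    (H : RepresentsLC t n φ h) (s : R) : RepresentsLC t n (s • φ) (s • h) := by
  obtain ⟨e, he, rfl⟩ := H
  exact ⟨_, he.smul s, map_smul _ _ _⟩

lemma cocycle {φ : (powRes I t).complex.X n ⟶ Y} {h : (localCohomology I n).obj Y}
    (H : RepresentsLC t n φ h) : (powRes I t).complex.d (n + 1) n ≫ φ = 0 := by
  obtain ⟨e, he, rfl⟩ := H
  exact he.cocycle

lemma exists_right (φ : (powRes I t).complex.X n ⟶ Y)
    (H : (powRes I t).complex.d (n + 1) n ≫ φ = 0) : ∃ h, RepresentsLC t n φ h := by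
  obtain ⟨e, he⟩ := RepresentsExt.exists_right φ H
  exact ⟨_, e, he, rfl⟩

lemma exists_left (h : (localCohomology I n).obj Y) : ∃ t φ, RepresentsLC (I := I) t n φ h := by
  obtain ⟨t, e, rfl⟩ := exists_extToLocalCohomology_eq h
  obtain ⟨φ, hφ⟩ := RepresentsExt.exists_left (powRes I t) e
  exact ⟨t, φ, e, hφ, rfl⟩

lemma map_right {Z : ModuleCat.{u} R} (g : Y ⟶ Z) {φ : (powRes I t).complex.X n ⟶ Y}
    {h : (localCohomology I n).obj Y} (H : RepresentsLC t n φ h) :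
    RepresentsLC t n (φ ≫ g) ((localCohomology I n).map g h) := by
  obtain ⟨e, he, rfl⟩ := H
  exact ⟨_, he.map_right g, congr($(extToLocalCohomology_map_right g t n) e)⟩

lemma lift {φ : (powRes I t).complex.X n ⟶ Y}
    {h : (localCohomology I n).obj Y} (H : RepresentsLC t n φ h) {t' : ℕ} (ht : t ≤ t') :
    RepresentsLC t' n ((powLift I ht).f n ≫ φ) h := by
  obtain ⟨e, he, rfl⟩ := H
  exact ⟨_, he.map_left _ _ (powLift_comm I ht),
    congr($(extToLocalCohomology_map_left ht n Y) e)⟩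

lemma eq_zero {φ : (powRes I t).complex.X n ⟶ Y}
    {h : (localCohomology I n).obj Y} (H : RepresentsLC t n φ h)
    (w : (powRes I t).complex.X (n - 1) ⟶ Y) (hw : (powRes I t).complex.d n (n - 1) ≫ w = φ) :
    h = 0 := by
  obtain ⟨e, he, rfl⟩ := H
  rw [he.eq_zero_iff.2 ⟨w, hw⟩, map_zero]

lemma exists_of_eq_zero {φ : (powRes I t).complex.X n ⟶ Y} (H : RepresentsLC t n φ 0) :
    ∃ (t' : ℕ) (ht : t ≤ t') (w : (powRes I t').complex.X (n - 1) ⟶ Y),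
      (powRes I t').complex.d n (n - 1) ≫ w = (powLift I ht).f n ≫ φ := by
  obtain ⟨e, he, h0⟩ := H
  obtain ⟨t', ht, h⟩ := extToLocalCohomology_eq_zero e h0
  obtain ⟨w, hw⟩ := (he.map_left _ _ (powLift_comm I ht)).eq_zero_iff.1 h
  exact ⟨t', ht, w, hw⟩

end RepresentsLC

end LocalCohomologyClasses

section LongExactSequence

open Limits

variable {R : Type u} [CommRing R]

lemma exists_linearMap_of_graph {A B : Type*} [AddCommGroup A] [AddCommGroup B] [Module R A]
    [Module R B] (G : Submodule R (A × B)) (htot : ∀ a, ∃ b, (a, b) ∈ G)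
    (hsv : ∀ b, ((0 : A), b) ∈ G → b = 0) :
    ∃ δ : A →ₗ[R] B, ∀ a b, (a, b) ∈ G ↔ δ a = b := by
  choose δ hδ using htot
  have key : ∀ a b, (a, b) ∈ G → b = δ a := fun a b h =>
    sub_eq_zero.1 (hsv _ (by simpa using G.sub_mem h (hδ a)))
  refine ⟨⟨⟨δ, fun a a' => ?_⟩, fun s a => ?_⟩, fun a b => ⟨fun h => (key a b h).symm, ?_⟩⟩
  · exact (key _ _ (by simpa using G.add_mem (hδ a) (hδ a'))).symm
  · exact (key _ _ (by simpa using G.smul_mem s (hδ a))).symm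
  · rintro rfl
    exact hδ a

lemma ModuleCat.exists_lift_of_surjective {P Y Z : ModuleCat.{u} R} [Projective P] (g : Y ⟶ Z)
    (hg : Function.Surjective g) (w : P ⟶ Z) : ∃ w' : P ⟶ Y, w' ≫ g = w := by
  have := (ModuleCat.epi_iff_surjective g).2 hg
  exact ⟨Projective.factorThru w g, Projective.factorThru_comp _ _⟩

lemma ModuleCat.exists_lift_of_exact {P X Y Z : ModuleCat.{u} R} (f : X ⟶ Y) (g : Y ⟶ Z)
    (hf : Function.Injective f) (hfg : Function.Exact f g) (α : P ⟶ Y) (hα : α ≫ g = 0) :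
    ∃ χ : P ⟶ X, χ ≫ f = α := by
  have h : ∀ p, α p ∈ LinearMap.range f.hom := fun p => (hfg _).1 congr($hα p)
  refine ⟨ModuleCat.ofHom ((LinearEquiv.ofInjective f.hom hf).symm.toLinearMap ∘ₗ
    α.hom.codRestrict _ h), ?_⟩
  ext p
  exact congr_arg Subtype.val ((LinearEquiv.ofInjective f.hom hf).apply_symm_apply ⟨α p, h p⟩)

variable {I : Ideal R}

namespace RepresentsLC

variable {t n : ℕ} {Y : ModuleCat.{u} R}

lemma sub {φ φ' : (powRes I t).complex.X n ⟶ Y} {h h' : (localCohomology I n).obj Y}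
    (H : RepresentsLC t n φ h) (H' : RepresentsLC t n φ' h') :
    RepresentsLC t n (φ - φ') (h - h') := by
  have := H.add (H'.smul (-1))
  simpa [sub_eq_add_neg] using this

lemma unique {φ : (powRes I t).complex.X n ⟶ Y} {h h' : (localCohomology I n).obj Y}
    (H : RepresentsLC t n φ h) (H' : RepresentsLC t n φ h') : h = h' :=
  sub_eq_zero.1 ((H.sub H').eq_zero 0 (by simp))

lemma zero : RepresentsLC (I := I) t n (0 : (powRes I t).complex.X n ⟶ Y) 0 := by
  obtain ⟨h, hh⟩ := exists_right (I := I) (t := t) (n := n) (Y := Y) 0 (by simp)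
  rwa [hh.eq_zero 0 (by simp)] at hh

end RepresentsLC

/-- Local cohomology of a module. -/
abbrev LC (I : Ideal R) (i : ℕ) (M : Type u) [AddCommGroup M] [Module R M] : Type u :=
  (localCohomology I i).obj (ModuleCat.of R M)

namespace LC

variable {X Y Z : Type u} [AddCommGroup X] [AddCommGroup Y] [AddCommGroup Z]
  [Module R X] [Module R Y] [Module R Z]

/-- The map on local cohomology induced by a linear map. -/
def map (I : Ideal R) (i : ℕ) (f : X →ₗ[R] Y) : LC I i X →ₗ[R] LC I i Y :=
  ((localCohomology I i).map (ModuleCat.ofHom f)).hom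

protected lemma map_comp (i : ℕ) (f : X →ₗ[R] Y) (g : Y →ₗ[R] Z) :
    map I i (g ∘ₗ f) = map I i g ∘ₗ map I i f := by
  rw [map, ModuleCat.ofHom_comp, Functor.map_comp]
  rfl

protected lemma map_id (i : ℕ) : map I i (LinearMap.id : X →ₗ[R] X) = LinearMap.id := by
  rw [map, ModuleCat.ofHom_id, CategoryTheory.Functor.map_id]
  rfl

protected lemma map_smul (i : ℕ) (s : R) (f : X →ₗ[R] Y) : map I i (s • f) = s • map I i f := by
  ext h
  obtain ⟨t, φ, H⟩ := RepresentsLC.exists_left h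
  have h1 := H.map_right (ModuleCat.ofHom (s • f))
  have h2 := (H.map_right (ModuleCat.ofHom f)).smul s
  refine h1.unique ?_
  rw [← Linear.comp_smul] at h2
  exact h2

/-- The relation underlying the connecting homomorphism. -/
def ConnRel (I : Ideal R) (f : X →ₗ[R] Y) (g : Y →ₗ[R] Z) (i : ℕ) (h : LC I i Z)
    (k : LC I (i + 1) X) : Prop :=
  ∃ (t : ℕ) (φ : (powRes I t).complex.X i ⟶ ModuleCat.of R Y)
    (ψ : (powRes I t).complex.X (i + 1) ⟶ ModuleCat.of R X),
    (powRes I t).complex.d (i + 1) i ≫ φ = ψ ≫ ModuleCat.ofHom f ∧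
    RepresentsLC t i (φ ≫ ModuleCat.ofHom g) h ∧ RepresentsLC t (i + 1) ψ k

variable {f : X →ₗ[R] Y} {g : Y →ₗ[R] Z} {i : ℕ}

lemma lift_comm {W W' : ModuleCat.{u} R} {t t' : ℕ} (ht : t ≤ t')
    {φ : (powRes I t).complex.X i ⟶ W}
    {ψ : (powRes I t).complex.X (i + 1) ⟶ W'} {f : W' ⟶ W}
    (h : (powRes I t).complex.d (i + 1) i ≫ φ = ψ ≫ f) :
    (powRes I t').complex.d (i + 1) i ≫ ((powLift I ht).f i ≫ φ) =
      ((powLift I ht).f (i + 1) ≫ ψ) ≫ f := by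
  rw [Category.assoc, ← h, ← Category.assoc, ← Category.assoc, (powLift I ht).comm]

/-- The graph of the connecting homomorphism. -/
def connGraph (I : Ideal R) (f : X →ₗ[R] Y) (g : Y →ₗ[R] Z) (i : ℕ) :
    Submodule R (LC I i Z × LC I (i + 1) X) where
  carrier := {p | ConnRel I f g i p.1 p.2}
  zero_mem' := ⟨0, 0, 0, by simp, by simpa using RepresentsLC.zero, RepresentsLC.zero⟩
  add_mem' := by
    rintro ⟨h, k⟩ ⟨h', k'⟩ ⟨t, φ, ψ, h1, h2, h3⟩ ⟨t', φ', ψ', h1', h2', h3'⟩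
    refine ⟨max t t', (powLift I (le_max_left t t')).f i ≫ φ +
      (powLift I (le_max_right t t')).f i ≫ φ', _, ?_, ?_,
      (h3.lift (le_max_left _ _)).add (h3'.lift (le_max_right _ _))⟩
    · rw [Preadditive.comp_add, Preadditive.add_comp, lift_comm _ h1, lift_comm _ h1']
    · have := (h2.lift (le_max_left t t')).add (h2'.lift (le_max_right t t'))
      simpa [Preadditive.add_comp] using this
  smul_mem' := by
    rintro s ⟨h, k⟩ ⟨t, φ, ψ, h1, h2, h3⟩
    refine ⟨t, s • φ, s • ψ, ?_, ?_, h3.smul s⟩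
    · rw [Linear.comp_smul, Linear.smul_comp, h1]
    · rw [Linear.smul_comp]
      exact h2.smul s

lemma connGraph_total (hf : Function.Injective f) (hfg : Function.Exact f g)
    (hg : Function.Surjective g) (h : LC I i Z) : ∃ k, (h, k) ∈ connGraph I f g i := by
  obtain ⟨t, φ₀, H⟩ := RepresentsLC.exists_left h
  have := (powRes I t).projective i
  obtain ⟨φ, rfl⟩ := ModuleCat.exists_lift_of_surjective (ModuleCat.ofHom g) hg φ₀
  obtain ⟨ψ, hψ⟩ := ModuleCat.exists_lift_of_exact (ModuleCat.ofHom f) (ModuleCat.ofHom g) hf hfg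
    ((powRes I t).complex.d (i + 1) i ≫ φ) (by rw [Category.assoc, H.cocycle])
  have hmono := (ModuleCat.mono_iff_injective (ModuleCat.ofHom f)).2 hf
  obtain ⟨k, hk⟩ := RepresentsLC.exists_right (I := I) ψ (by
    rw [← cancel_mono (ModuleCat.ofHom f), Category.assoc, hψ, ← Category.assoc]
    simp)
  exact ⟨k, t, φ, ψ, hψ.symm, H, hk⟩

lemma connGraph_left_zero (hf : Function.Injective f) (hfg : Function.Exact f g)
    (hg : Function.Surjective g) (k : LC I (i + 1) X) (h : (0, k) ∈ connGraph I f g i) :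
    k = 0 := by
  obtain ⟨t, φ, ψ, h1, h2, h3⟩ := h
  obtain ⟨t', ht, w, hw⟩ := h2.exists_of_eq_zero
  have := (powRes I t').projective (i - 1)
  obtain ⟨w, rfl⟩ := ModuleCat.exists_lift_of_surjective (ModuleCat.ofHom g) hg w
  obtain ⟨χ, hχ⟩ := ModuleCat.exists_lift_of_exact (ModuleCat.ofHom f) (ModuleCat.ofHom g) hf hfg
    ((powLift I ht).f i ≫ φ - (powRes I t').complex.d i (i - 1) ≫ w)
    (by rw [Preadditive.sub_comp, Category.assoc, Category.assoc, hw, sub_self])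
  refine (h3.lift ht).eq_zero χ ?_
  have hmono := (ModuleCat.mono_iff_injective (ModuleCat.ofHom f)).2 hf
  rw [← cancel_mono (ModuleCat.ofHom f), Category.assoc]
  erw [hχ]
  rw [Preadditive.comp_sub, ← lift_comm ht h1]
  simp

lemma exists_of_connGraph_right_zero (h : LC I i Z)
    (H : (h, 0) ∈ connGraph I f g i) (hfg : Function.Exact f g) : ∃ a, map I i g a = h := by
  obtain ⟨t, φ, ψ, h1, h2, h3⟩ := H
  obtain ⟨t', ht, χ, hχ⟩ := h3.exists_of_eq_zero
  have h1' := lift_comm ht h1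
  have h0 : ModuleCat.ofHom f ≫ ModuleCat.ofHom g = 0 := by
    ext x
    exact hfg.apply_apply_eq_zero x
  obtain ⟨a, ha⟩ := RepresentsLC.exists_right (I := I)
    ((powLift I ht).f i ≫ φ - (show (powRes I t').complex.X i ⟶ _ from χ) ≫ ModuleCat.ofHom f) (by
      rw [Preadditive.comp_sub, h1', ← hχ]
      simp)
  refine ⟨a, (ha.map_right (ModuleCat.ofHom g)).unique ?_⟩
  have := h2.lift ht
  rw [Preadditive.sub_comp, Category.assoc, Category.assoc, h0, Limits.comp_zero, sub_zero]
  exact this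

lemma connGraph_map (a : LC I i Y) :
    (map I i g a, 0) ∈ connGraph I f g i := by
  obtain ⟨t, α, H⟩ := RepresentsLC.exists_left a
  exact ⟨t, α, 0, by rw [H.cocycle, Limits.zero_comp], H.map_right _, RepresentsLC.zero⟩

lemma map_of_connGraph {h : LC I i Z} {k : LC I (i + 1) X} (H : (h, k) ∈ connGraph I f g i) :
    map I (i + 1) f k = 0 := by
  obtain ⟨t, φ, ψ, h1, h2, h3⟩ := H
  exact (h3.map_right (ModuleCat.ofHom f)).eq_zero φ h1

lemma connGraph_of_map_eq_zero (hfg : Function.Exact f g) {k : LC I (i + 1) X}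
    (hk : map I (i + 1) f k = 0) : ∃ h, (h, k) ∈ connGraph I f g i := by
  obtain ⟨t, ψ, H⟩ := RepresentsLC.exists_left k
  have H' := H.map_right (ModuleCat.ofHom f)
  rw [show (ConcreteCategory.hom ((localCohomology I (i + 1)).map (ModuleCat.ofHom f))) k = 0
    from hk] at H'
  obtain ⟨t', ht, φ, hφ⟩ := H'.exists_of_eq_zero
  have h0 : ModuleCat.ofHom f ≫ ModuleCat.ofHom g = 0 := by
    ext x
    exact hfg.apply_apply_eq_zero x
  change (powRes I t').complex.X i ⟶ _ at φ
  obtain ⟨h, hh⟩ := RepresentsLC.exists_right (I := I) (φ ≫ ModuleCat.ofHom g) (by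
    have : (powRes I t').complex.d (i + 1) i ≫ φ = _ := hφ
    rw [← Category.assoc, this, Category.assoc, Category.assoc, h0]
    simp)
  exact ⟨h, t', φ, (powLift I ht).f (i + 1) ≫ ψ, by rw [Category.assoc]; exact hφ, hh, H.lift ht⟩

lemma exists_connecting (hf : Function.Injective f) (hfg : Function.Exact f g)
    (hg : Function.Surjective g) (I : Ideal R) (i : ℕ) :
    ∃ δ : LC I i Z →ₗ[R] LC I (i + 1) X,
      Function.Exact (map I i g) δ ∧ Function.Exact δ (map I (i + 1) f) := by
  obtain ⟨δ, hδ⟩ := exists_linearMap_of_graph (connGraph I f g i)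
    (connGraph_total hf hfg hg) (connGraph_left_zero hf hfg hg)
  refine ⟨δ, fun h => ⟨fun hh => ?_, ?_⟩, fun k => ⟨fun hk => ?_, ?_⟩⟩
  · exact exists_of_connGraph_right_zero h ((hδ _ _).2 hh) hfg
  · rintro ⟨a, rfl⟩
    exact (hδ _ _).1 (connGraph_map a)
  · obtain ⟨h, hh⟩ := connGraph_of_map_eq_zero hfg hk
    exact ⟨h, (hδ _ _).1 hh⟩
  · rintro ⟨h, rfl⟩
    exact map_of_connGraph ((hδ h _).2 rfl)

lemma map_exact (hf : Function.Injective f) (hfg : Function.Exact f g)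
    (hg : Function.Surjective g) (I : Ideal R) (i : ℕ) :
    Function.Exact (map I i f) (map I i g) := by
  intro a
  constructor
  · intro ha
    obtain ⟨t, α, H⟩ := RepresentsLC.exists_left a
    have H' := H.map_right (ModuleCat.ofHom g)
    rw [show (ConcreteCategory.hom ((localCohomology I i).map (ModuleCat.ofHom g))) a = 0
      from ha] at H'
    obtain ⟨t', ht, w, hw⟩ := H'.exists_of_eq_zero
    have := (powRes I t').projective (i - 1)
    obtain ⟨w, rfl⟩ := ModuleCat.exists_lift_of_surjective (ModuleCat.ofHom g) hg w
    obtain ⟨χ, hχ⟩ := ModuleCat.exists_lift_of_exact (ModuleCat.ofHom f) (ModuleCat.ofHom g) hf hfg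
      ((powLift I ht).f i ≫ α - (powRes I t').complex.d i (i - 1) ≫ w)
      (by rw [Preadditive.sub_comp, Category.assoc, Category.assoc, hw, sub_self])
    have hmono := (ModuleCat.mono_iff_injective (ModuleCat.ofHom f)).2 hf
    obtain ⟨k, hk⟩ := RepresentsLC.exists_right (I := I) χ (by
      rw [← cancel_mono (ModuleCat.ofHom f), Category.assoc, hχ, Preadditive.comp_sub,
        (H.lift ht).cocycle]
      simp)
    refine ⟨k, ?_⟩
    have h2 := (hk.map_right (ModuleCat.ofHom f))
    rw [hχ] at h2
    have h3 := (H.lift ht).sub h2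
    exact (sub_eq_zero.1 (h3.eq_zero w (by simp))).symm
  · rintro ⟨k, rfl⟩
    have h0 : g ∘ₗ f = (0 : R) • (0 : X →ₗ[R] Z) := by
      ext x
      simpa using hfg.apply_apply_eq_zero x
    rw [← LinearMap.comp_apply, ← LC.map_comp, h0, LC.map_smul, zero_smul, LinearMap.zero_apply]

lemma map_zero_injective (hf : Function.Injective f) :
    Function.Injective (map I 0 f) := by
  rw [injective_iff_map_eq_zero]
  intro k hk
  obtain ⟨t, ψ, H⟩ := RepresentsLC.exists_left k
  have H' := H.map_right (ModuleCat.ofHom f)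
  rw [show (ConcreteCategory.hom ((localCohomology I 0).map (ModuleCat.ofHom f))) k = 0
      from hk] at H'
  obtain ⟨t', ht, w, hw⟩ := H'.exists_of_eq_zero
  have hmono := (ModuleCat.mono_iff_injective (ModuleCat.ofHom f)).2 hf
  refine (H.lift ht).eq_zero 0 ?_
  have h0 : ((powLift I ht).f 0 ≫ ψ) ≫ ModuleCat.ofHom f = 0 := by
    rw [Category.assoc, ← hw]
    simp
  rw [← cancel_mono (ModuleCat.ofHom f), h0]
  simp

lemma eq_zero_of_injective [hX : Module.Injective R X] (h : LC I (i + 1) X) : h = 0 := by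
  have hX := Module.injective_object_of_injective_module R X
  obtain ⟨t, φ, H⟩ := RepresentsLC.exists_left h
  have hw : (powRes I t).complex.d (i + 1) i ≫
      ((powRes I t).exact_succ i).descToInjective φ H.cocycle = φ :=
    ((powRes I t).exact_succ i).comp_descToInjective φ H.cocycle
  exact H.eq_zero _ hw

end LC

end LongExactSequence

section Torsion

variable {R : Type u} [CommRing R] (I : Ideal R) (Y Z : Type u) [AddCommGroup Y] [AddCommGroup Z]
  [Module R Y] [Module R Z]

/-- The submodule of elements killed by a power of `I`. -/
def powTorsion : Submodule R Y where
  carrier := {y | ∃ t : ℕ, ∀ a ∈ I ^ t, a • y = 0}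
  zero_mem' := ⟨0, by simp⟩
  add_mem' := by
    rintro y y' ⟨t, h⟩ ⟨t', h'⟩
    refine ⟨max t t', fun a ha => ?_⟩
    rw [smul_add, h a (Ideal.pow_le_pow_right (le_max_left _ _) ha),
      h' a (Ideal.pow_le_pow_right (le_max_right _ _) ha), add_zero]
  smul_mem' := by
    rintro s y ⟨t, h⟩
    exact ⟨t, fun a ha => by rw [smul_comm, h a ha, smul_zero]⟩

variable {I Y Z}

lemma mem_powTorsion {y : Y} : y ∈ powTorsion I Y ↔ ∃ t : ℕ, ∀ a ∈ I ^ t, a • y = 0 := Iff.rfl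

lemma map_mem_powTorsion (g : Y →ₗ[R] Z) {y : Y} (hy : y ∈ powTorsion I Y) :
    g y ∈ powTorsion I Z := by
  obtain ⟨t, h⟩ := hy
  exact ⟨t, fun a ha => by rw [← map_smul, h a ha, map_zero]⟩

/-- The map `R ⧸ I ^ t → Y` given by an element killed by `I ^ t`. -/
def torsionHom (t : ℕ) (y : Y) (h : ∀ a ∈ I ^ t, a • y = 0) :
    ModuleCat.of R (R ⧸ I ^ t) ⟶ ModuleCat.of R Y :=
  ModuleCat.ofHom (Submodule.liftQ (I ^ t) (LinearMap.toSpanSingleton R Y y)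
    (fun a ha => h a ha))

namespace LC

variable (I) in
/-- The augmentation of the resolution of `R ⧸ I ^ t`. -/
def powAug (t : ℕ) : (powRes I t).complex.X 0 ⟶ ModuleCat.of R (R ⧸ I ^ t) := (powRes I t).π.f 0

lemma d_comp_powAug (t : ℕ) : (powRes I t).complex.d 1 0 ≫ powAug I t = 0 :=
  (powRes I t).complex_d_comp_π_f_zero

lemma powLift_comp_powAug {t t' : ℕ} (ht : t ≤ t') :
    (powLift I ht).f 0 ≫ powAug I t = powAug I t' ≫ powProj I ht := powLift_comm I ht

instance epi_powAug (t : ℕ) : Epi (powAug I t) :=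
  inferInstanceAs (Epi ((powRes I t).π.f 0))

/-- The cocycle given by an element killed by `I ^ t`. -/
def torsionCocycle (t : ℕ) (y : Y) (h : ∀ a ∈ I ^ t, a • y = 0) :
    (powRes I t).complex.X 0 ⟶ ModuleCat.of R Y :=
  powAug I t ≫ torsionHom t y h

lemma torsionHom_ext {t : ℕ} {f g : ModuleCat.of R (R ⧸ I ^ t) ⟶ ModuleCat.of R Y}
    (h : f (Ideal.Quotient.mk _ 1) = g (Ideal.Quotient.mk _ 1)) : f = g := by
  ext
  exact h

lemma powLift_torsionCocycle {t t' : ℕ} (ht : t ≤ t') (y : Y) (h : ∀ a ∈ I ^ t, a • y = 0) :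
    (powLift I ht).f 0 ≫ torsionCocycle t y h =
      torsionCocycle t' y (fun a ha => h a (Ideal.pow_le_pow_right ht ha)) := by
  have h1 : torsionHom t' y (fun a ha => h a (Ideal.pow_le_pow_right ht ha)) =
      powProj I ht ≫ torsionHom t y h := by
    apply torsionHom_ext
    rfl
  rw [torsionCocycle, torsionCocycle, h1, ← Category.assoc, powLift_comp_powAug, Category.assoc]

/-- `h` is the class in degree zero of the torsion element `y`. -/
def TorsionRel (y : Y) (h : LC I 0 Y) : Prop :=
  ∃ (t : ℕ) (hy : ∀ a ∈ I ^ t, a • y = 0), RepresentsLC t 0 (torsionCocycle t y hy) h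

lemma TorsionRel.lift {y : Y} {h : LC I 0 Y} (H : TorsionRel y h) :
    ∃ t, ∀ t' ≥ t, ∃ (hy : ∀ a ∈ I ^ t', a • y = 0), RepresentsLC t' 0 (torsionCocycle t' y hy) h := by
  obtain ⟨t, hy, H⟩ := H
  refine ⟨t, fun t' ht => ⟨fun a ha => hy a (Ideal.pow_le_pow_right ht ha), ?_⟩⟩
  rw [← powLift_torsionCocycle ht]
  exact H.lift ht

lemma TorsionRel.add {y y' : Y} {h h' : LC I 0 Y} (H : TorsionRel y h) (H' : TorsionRel y' h') :
    TorsionRel (y + y') (h + h') := by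
  obtain ⟨t, H⟩ := H.lift
  obtain ⟨t', H'⟩ := H'.lift
  obtain ⟨hy, H⟩ := H _ (le_max_left t t')
  obtain ⟨hy', H'⟩ := H' _ (le_max_right t t')
  have h0 : ∀ a ∈ I ^ (max t t'), a • (y + y') = 0 := fun a ha => by
    rw [smul_add, hy a ha, hy' a ha, add_zero]
  refine ⟨_, h0, ?_⟩
  convert H.add H' using 1
  rw [torsionCocycle, torsionCocycle, torsionCocycle, ← Preadditive.comp_add]
  congr 1
  apply torsionHom_ext
  change (1 : R) • (y + y') = (1 : R) • y + (1 : R) • y'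
  exact smul_add _ _ _

lemma TorsionRel.smul {y : Y} {h : LC I 0 Y} (s : R) (H : TorsionRel y h) :
    TorsionRel (s • y) (s • h) := by
  obtain ⟨t, hy, H⟩ := H
  refine ⟨t, fun a ha => by rw [smul_comm, hy a ha, smul_zero], ?_⟩
  convert H.smul s using 1
  rw [torsionCocycle, torsionCocycle, ← Linear.comp_smul]
  congr 1
  apply torsionHom_ext
  change (1 : R) • s • y = s • (1 : R) • y
  exact smul_comm _ _ _

lemma TorsionRel.map {y : Y} {h : LC I 0 Y} (g : Y →ₗ[R] Z) (H : TorsionRel y h) :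
    TorsionRel (g y) (LC.map I 0 g h) := by
  obtain ⟨t, hy, H⟩ := H
  refine ⟨t, fun a ha => by rw [← map_smul, hy a ha, map_zero], ?_⟩
  have h1 : RepresentsLC t 0 (torsionCocycle t y hy ≫ ModuleCat.ofHom g) (LC.map I 0 g h) :=
    H.map_right _
  convert h1 using 1
  rw [torsionCocycle, torsionCocycle, Category.assoc]
  congr 1
  apply torsionHom_ext
  change (1 : R) • g y = g ((1 : R) • y)
  exact (map_smul _ _ _).symm

lemma TorsionRel.eq_zero {h : LC I 0 Y} (H : TorsionRel (0 : Y) h) : h = 0 := by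
  obtain ⟨t, hy, H⟩ := H
  refine H.eq_zero 0 ?_
  rw [torsionCocycle, show torsionHom t (0 : Y) hy = 0 from ?_]
  · simp
  · apply torsionHom_ext
    change (1 : R) • (0 : Y) = 0
    exact smul_zero _

lemma TorsionRel.eq_zero' {y : Y} (H : TorsionRel (I := I) y 0) : y = 0 := by
  obtain ⟨t, hy, H⟩ := H
  obtain ⟨t', ht, w, hw⟩ := H.exists_of_eq_zero
  rw [powLift_torsionCocycle] at hw
  have h0 : (powRes I t').complex.d 0 (0 - 1) ≫ w = 0 := by simp
  rw [h0, torsionCocycle] at hw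
  have h1 := (epi_powAug t').left_cancellation (torsionHom t' y _) 0 (hw.symm.trans (by simp))
  have h2 := congr($h1 (Ideal.Quotient.mk _ 1))
  change (1 : R) • y = 0 at h2
  rwa [one_smul] at h2

lemma exists_torsionRel (y : Y) (hy : y ∈ powTorsion I Y) : ∃ h, TorsionRel (I := I) y h := by
  obtain ⟨t, hy⟩ := hy
  obtain ⟨h, H⟩ := RepresentsLC.exists_right (I := I) (torsionCocycle t y hy) (by
    rw [torsionCocycle, ← Category.assoc, d_comp_powAug, Limits.zero_comp])
  exact ⟨h, t, hy, H⟩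

lemma exists_torsionRel' (h : LC I 0 Y) : ∃ y, TorsionRel y h := by
  obtain ⟨t, φ, H⟩ := RepresentsLC.exists_left h
  have hepi : Epi (ShortComplex.mk _ _ (powRes I t).complex_d_comp_π_f_zero).g := epi_powAug t
  obtain ⟨ψ, hψ⟩ : ∃ ψ : ModuleCat.of R (R ⧸ I ^ t) ⟶ ModuleCat.of R Y,
      powAug I t ≫ ψ = φ :=
    ⟨(powRes I t).exact₀.desc φ H.cocycle, (powRes I t).exact₀.g_desc φ H.cocycle⟩
  have hy : ∀ a ∈ I ^ t, a • ψ (Ideal.Quotient.mk _ 1) = 0 := fun a ha => by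
    rw [← map_smul]
    have : a • (Ideal.Quotient.mk (I ^ t) 1) = Ideal.Quotient.mk (I ^ t) a := by
      rw [← Ideal.Quotient.mk_eq_mk, ← Submodule.Quotient.mk_smul, smul_eq_mul, mul_one]
      rfl
    rw [this, Ideal.Quotient.eq_zero_iff_mem.2 ha, map_zero]
  refine ⟨ψ (Ideal.Quotient.mk _ 1), t, hy, ?_⟩
  convert H
  rw [torsionCocycle, ← hψ]
  congr 1
  apply torsionHom_ext
  exact one_smul R _

variable (I Y) in
lemma exists_torsionEquiv : ∃ e : powTorsion I Y ≃ₗ[R] LC I 0 Y, ∀ y, TorsionRel y.1 (e y) := by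
  obtain ⟨δ, hδ⟩ := exists_linearMap_of_graph (A := powTorsion I Y) (B := LC I 0 Y)
    { carrier := {p | TorsionRel p.1.1 p.2}
      zero_mem' := by
        obtain ⟨h, hh⟩ := exists_torsionRel (I := I) (0 : Y) (Submodule.zero_mem _)
        have := hh.eq_zero
        subst this
        exact hh
      add_mem' := fun H H' => TorsionRel.add H H'
      smul_mem' := fun s _ H => TorsionRel.smul s H }
    (fun y => exists_torsionRel y.1 y.2) (fun b hb => TorsionRel.eq_zero hb)
  have h1 : ∀ y, TorsionRel y.1 (δ y) := fun y => (hδ y _).2 rfl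
  refine ⟨LinearEquiv.ofBijective δ ⟨?_, fun h => ?_⟩, h1⟩
  · rw [injective_iff_map_eq_zero]
    intro y hy
    have := h1 y
    rw [hy] at this
    exact Subtype.ext this.eq_zero'
  · obtain ⟨y, hy⟩ := exists_torsionRel' h
    have hmem : y ∈ powTorsion I Y := by
      obtain ⟨t, h, -⟩ := hy
      exact ⟨t, h⟩
    exact ⟨⟨y, hmem⟩, (hδ ⟨y, hmem⟩ h).1 hy⟩

variable (I Y) in
/-- Local cohomology in degree zero is the torsion submodule. -/
def torsionEquiv : powTorsion I Y ≃ₗ[R] LC I 0 Y := (exists_torsionEquiv I Y).choose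

lemma torsionEquiv_spec (y : powTorsion I Y) : TorsionRel y.1 (torsionEquiv I Y y) :=
  (exists_torsionEquiv I Y).choose_spec y

lemma map_torsionEquiv (g : Y →ₗ[R] Z) (y : powTorsion I Y) :
    map I 0 g (torsionEquiv I Y y) = torsionEquiv I Z ⟨g y.1, map_mem_powTorsion g y.2⟩ := by
  have h1 := (torsionEquiv_spec y).map g
  have h2 := torsionEquiv_spec (I := I) ⟨g y.1, map_mem_powTorsion g y.2⟩
  have h3 := h1.add (h2.smul (-1))
  rw [neg_one_smul, neg_one_smul, add_neg_cancel] at h3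
  exact eq_of_sub_eq_zero ((sub_eq_add_neg _ _).trans h3.eq_zero)

end LC

end Torsion

section LocalCohomologyProperties

variable {R : Type u} [CommRing R] {I : Ideal R}

lemma exists_injective_embedding (M : Type u) [AddCommGroup M] [Module R M] :
    ∃ (E : Type u) (_ : AddCommGroup E) (_ : Module R E) (f : M →ₗ[R] E),
      Function.Injective f ∧ Module.Injective R E := by
  have : Injective (ModuleCat.of R (Injective.under (ModuleCat.of R M) : ModuleCat.{u} R)) :=
    inferInstanceAs (Injective (Injective.under (ModuleCat.of R M)))
  exact ⟨(Injective.under (ModuleCat.of R M) : ModuleCat.{u} R), inferInstance, inferInstance,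
    (Injective.ι (ModuleCat.of R M)).hom, (ModuleCat.mono_iff_injective _).1 inferInstance,
    Module.injective_module_of_injective_object R _⟩

namespace LC

variable {X Y Z M : Type u} [AddCommGroup X] [AddCommGroup Y] [AddCommGroup Z] [AddCommGroup M]
  [Module R X] [Module R Y] [Module R Z] [Module R M]
  {f : X →ₗ[R] Y} {g : Y →ₗ[R] Z} {i : ℕ}

lemma map_lsmul (a : R) (h : LC I i M) : map I i (LinearMap.lsmul R M a) h = a • h := by
  have : LinearMap.lsmul R M a = a • LinearMap.id := by ext; rfl
  rw [this, LC.map_smul, LC.map_id]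
  rfl

lemma smul_eq_zero_of_smul_eq_zero (a : R) (ha : ∀ x : M, a • x = 0) (h : LC I i M) :
    a • h = 0 := by
  rw [← map_lsmul]
  have : LinearMap.lsmul R M a = (0 : R) • LinearMap.id := by
    ext x
    simpa using ha x
  rw [this, LC.map_smul, zero_smul, LinearMap.zero_apply]

lemma connecting_surjective {δ : LC I i Z →ₗ[R] LC I (i + 1) X}
    (hδ : Function.Exact δ (map I (i + 1) f)) (hY : ∀ h : LC I (i + 1) Y, h = 0) :
    Function.Surjective δ := fun k => (hδ k).1 (hY _)

lemma exists_pow_smul_eq_zero : ∀ (i : ℕ) (M : Type u) [AddCommGroup M] [Module R M]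
    (h : LC I i M), ∃ t : ℕ, ∀ a ∈ I ^ t, a • h = 0
  | 0, M, _, _, h => by
    obtain ⟨⟨y, t, hy⟩, rfl⟩ := (torsionEquiv I M).surjective h
    refine ⟨t, fun a ha => ?_⟩
    rw [← _root_.map_smul]
    convert _root_.map_zero (torsionEquiv I M)
    exact Subtype.ext (hy a ha)
  | i + 1, M, _, _, h => by
    obtain ⟨E, _, _, f, hf, hE⟩ := exists_injective_embedding (R := R) M
    obtain ⟨δ, -, h2⟩ := exists_connecting hf (LinearMap.exact_map_mkQ_range f)
      (Submodule.mkQ_surjective _) I i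
    obtain ⟨k, rfl⟩ := connecting_surjective h2 (fun h => eq_zero_of_injective h) h
    obtain ⟨t, ht⟩ := exists_pow_smul_eq_zero i _ k
    exact ⟨t, fun a ha => by rw [← _root_.map_smul, ht a ha, _root_.map_zero]⟩

lemma map_bijective (e : X ≃ₗ[R] Y) : Function.Bijective (map I i e.toLinearMap) := by
  refine Function.bijective_iff_has_inverse.2 ⟨map I i e.symm.toLinearMap, fun h => ?_, fun h => ?_⟩
  · rw [← LinearMap.comp_apply, ← LC.map_comp]
    simp [LC.map_id]
  · rw [← LinearMap.comp_apply, ← LC.map_comp]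
    simp [LC.map_id]

lemma smul_injective_of_bijective (a : R) (ha : Function.Bijective fun x : M => a • x) :
    Function.Injective fun h : LC I i M => a • h := by
  have := (map_bijective (I := I) (i := i)
    (LinearEquiv.ofBijective (LinearMap.lsmul R M a) ha)).1
  convert this using 2 with h
  exact (map_lsmul a h).symm

lemma eq_zero_of_bijective (a : R) (haI : a ∈ I) (ha : Function.Bijective fun x : M => a • x)
    (h : LC I i M) : h = 0 := by
  obtain ⟨t, ht⟩ := exists_pow_smul_eq_zero i M h
  have h1 := ht _ (Ideal.pow_mem_pow haI t)
  clear ht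
  induction t with
  | zero => simpa using h1
  | succ t ih =>
    apply ih
    apply smul_injective_of_bijective a ha
    simp only
    rw [smul_smul, ← pow_succ', h1, smul_zero]

end LC

lemma exists_pow_smul_eq_zero_of_finite {X : Type*} [AddCommGroup X]
    [Module R X] [Module.Finite R X] (h : ∀ x : X, ∃ t : ℕ, ∀ a ∈ I ^ t, a • x = 0) :
    ∃ t : ℕ, ∀ x : X, ∀ a ∈ I ^ t, a • x = 0 := by
  obtain ⟨s, hs⟩ := ‹Module.Finite R X›.fg_top
  choose t ht using h
  refine ⟨s.sup t, fun x a ha => ?_⟩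
  have hx : x ∈ Submodule.span R (s : Set X) := hs ▸ Submodule.mem_top
  induction hx using Submodule.span_induction with
  | mem y hy => exact ht y a (Ideal.pow_le_pow_right (Finset.le_sup (f := t) hy) ha)
  | zero => exact smul_zero a
  | add y z _ _ hy hz => rw [smul_add, hy, hz, add_zero]
  | smul b y _ hy => rw [smul_comm, hy, smul_zero]

instance injective_powTorsion [IsNoetherianRing R] (E : Type u) [AddCommGroup E] [Module R E]
    [hE : Module.Injective R E] : Module.Injective R (powTorsion I E) := by
  apply Module.Baer.injective
  intro 𝔞 g
  obtain ⟨t, ht⟩ := exists_pow_smul_eq_zero_of_finite (I := I) (X := LinearMap.range g) (by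
    rintro ⟨⟨y, t, hy⟩, -⟩
    exact ⟨t, fun a ha => Subtype.ext (Subtype.ext (hy a ha))⟩)
  obtain ⟨k, hk⟩ := Ideal.exists_pow_inf_eq_pow_smul (M := R) I 𝔞
  have hk := hk (k + t) (by omega)
  let φ : 𝔞 →ₗ[R] R ⧸ I ^ (k + t) := (I ^ (k + t)).mkQ ∘ₗ 𝔞.subtype
  have hφ : LinearMap.ker φ ≤ LinearMap.ker g := by
    rintro ⟨a, ha⟩ h
    have h1 : a ∈ I ^ (k + t) := by
      simpa [φ, Ideal.Quotient.eq_zero_iff_mem] using h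
    have h2 : a ∈ I ^ t • 𝔞 := by
      have : a ∈ I ^ (k + t) • (⊤ : Ideal R) ⊓ 𝔞 := ⟨by simpa using h1, ha⟩
      rw [hk, Nat.add_sub_cancel_left] at this
      exact Submodule.smul_mono le_rfl inf_le_right this
    have h3 : ∀ (x : R) (hx : x ∈ I ^ t • 𝔞) (hx' : x ∈ 𝔞), g ⟨x, hx'⟩ = 0 := by
      intro x hx
      induction hx using Submodule.smul_induction_on' with
      | smul b hb c hc =>
        intro hx'
        have := ht ⟨g ⟨c, hc⟩, ⟨c, hc⟩, rfl⟩ b hb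
        have h4 := congr_arg Subtype.val this
        rw [← show b • (⟨c, hc⟩ : 𝔞) = ⟨b • c, hx'⟩ from rfl, map_smul]
        exact h4
      | add b hb c hc h h' =>
        intro hx'
        have hb' : b ∈ 𝔞 := Submodule.smul_le_right hb
        have hc' : c ∈ 𝔞 := Submodule.smul_le_right hc
        rw [← show (⟨b, hb'⟩ : 𝔞) + (⟨c, hc'⟩ : 𝔞) = ⟨b + c, hx'⟩ from rfl, map_add, h, h',
          add_zero]
    exact h3 a h2 ha
  obtain ⟨h, hh⟩ := hE.out ((LinearMap.ker φ).liftQ φ le_rfl)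
    (by rw [← LinearMap.ker_eq_bot, Submodule.ker_liftQ_eq_bot' _ _ rfl])
    ((powTorsion I E).subtype ∘ₗ (LinearMap.ker φ).liftQ g hφ)
  refine ⟨LinearMap.codRestrict _ (h ∘ₗ (I ^ (k + t)).mkQ) fun x => ⟨k + t, fun a ha => ?_⟩, ?_⟩
  · have h0 : a • (I ^ (k + t)).mkQ x = 0 :=
      Ideal.Quotient.eq_zero_iff_mem.2 (Ideal.mul_mem_right _ _ ha)
    rw [LinearMap.comp_apply, ← map_smul, h0, map_zero]
  · intro x hx
    exact Subtype.ext (hh (Submodule.Quotient.mk ⟨x, hx⟩))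

lemma LC.eq_zero_of_torsion [IsNoetherianRing R] : ∀ (i : ℕ) (N : Type u) [AddCommGroup N]
    [Module R N] (_ : ∀ y : N, y ∈ powTorsion I N) (h : LC I (i + 1) N), h = 0 := by
  intro i
  induction i with
  | zero =>
    intro N _ _ hN h
    obtain ⟨E, _, _, f, hf, hE⟩ := exists_injective_embedding (R := R) N
    let f' : N →ₗ[R] powTorsion I E := f.codRestrict _ fun y => map_mem_powTorsion f (hN y)
    have hf' : Function.Injective f' := fun x y h => hf congr(($h).1)
    obtain ⟨δ, h1, h2⟩ := exists_connecting hf' (LinearMap.exact_map_mkQ_range f')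
      (Submodule.mkQ_surjective _) I 0
    obtain ⟨k, rfl⟩ := connecting_surjective h2 (fun h => eq_zero_of_injective h) h
    rw [h1 k]
    obtain ⟨⟨c, hc⟩, rfl⟩ := (torsionEquiv I _).surjective k
    obtain ⟨⟨e, t, he⟩, rfl⟩ := Submodule.mkQ_surjective _ c
    refine ⟨torsionEquiv I _ ⟨⟨e, t, he⟩, t, fun a ha => Subtype.ext (he a ha)⟩, ?_⟩
    rw [map_torsionEquiv]
  | succ i ih =>
    intro N _ _ hN h
    obtain ⟨E, _, _, f, hf, hE⟩ := exists_injective_embedding (R := R) N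
    let f' : N →ₗ[R] powTorsion I E := f.codRestrict _ fun y => map_mem_powTorsion f (hN y)
    have hf' : Function.Injective f' := fun x y h => hf congr(($h).1)
    obtain ⟨δ, h1, h2⟩ := exists_connecting hf' (LinearMap.exact_map_mkQ_range f')
      (Submodule.mkQ_surjective _) I (i + 1)
    obtain ⟨k, rfl⟩ := connecting_surjective h2 (fun h => eq_zero_of_injective h) h
    rw [ih _ ?_ k, map_zero]
    intro c
    obtain ⟨⟨e, t, he⟩, rfl⟩ := Submodule.mkQ_surjective _ c
    exact map_mem_powTorsion _ ⟨t, fun a ha => Subtype.ext (he a ha)⟩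

end LocalCohomologyProperties

section FiniteCriterion

variable {R : Type u} [CommRing R] {I : Ideal R}

lemma pow_smul_eq_zero_of_exact {A B C : Type*} [AddCommGroup A] [AddCommGroup B] [AddCommGroup C]
    [Module R A] [Module R B] [Module R C] {f : A →ₗ[R] B} {g : B →ₗ[R] C}
    (hfg : Function.Exact f g) {s t : ℕ} (hA : ∀ a ∈ I ^ s, ∀ x : A, a • x = 0)
    (hC : ∀ a ∈ I ^ t, ∀ x : C, a • x = 0) : ∀ a ∈ I ^ (s + t), ∀ x : B, a • x = 0 := by
  intro a ha x
  rw [pow_add] at ha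
  induction ha using Submodule.mul_induction_on' with
  | mem_mul_mem b hb c hc =>
    obtain ⟨y, hy⟩ := (hfg (c • x)).1 (by rw [map_smul, hC c hc])
    rw [mul_smul, ← hy, ← map_smul, hA b hb, map_zero]
  | add b _ c _ hb hc => rw [add_smul, hb, hc, add_zero]

variable (I) in
lemma powTorsion_quotient_eq_bot [IsNoetherianRing R] (M : Type u) [AddCommGroup M] [Module R M]
    (y : M ⧸ powTorsion I M) (hy : y ∈ powTorsion I (M ⧸ powTorsion I M)) : y = 0 := by
  obtain ⟨x, rfl⟩ := Submodule.mkQ_surjective _ y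
  obtain ⟨t, ht⟩ := hy
  rw [← LinearMap.mem_ker, Submodule.ker_mkQ]
  have h1 : ∀ a ∈ I ^ t, a • x ∈ powTorsion I M := fun a ha => by
    rw [← Submodule.ker_mkQ (powTorsion I M), LinearMap.mem_ker, map_smul, ht a ha]
  obtain ⟨s, hs⟩ := exists_pow_smul_eq_zero_of_finite (I := I)
    (X := (Submodule.map (LinearMap.toSpanSingleton R M x) (I ^ t) : Submodule R M)) (by
      rintro ⟨-, a, ha, rfl⟩
      obtain ⟨s, hs⟩ := h1 a ha
      exact ⟨s, fun b hb => Subtype.ext (hs b hb)⟩)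
  refine ⟨s + t, fun a ha => ?_⟩
  rw [pow_add] at ha
  induction ha using Submodule.mul_induction_on' with
  | mem_mul_mem b hb c hc =>
    rw [mul_smul]
    exact congr_arg Subtype.val (hs ⟨c • x, c, hc, rfl⟩ b hb)
  | add b _ c _ hb hc => rw [add_smul, hb, hc, add_zero]

lemma exists_isSMulRegular_of_powTorsion_eq_bot [IsNoetherianRing R] (M : Type u) [AddCommGroup M]
    [Module R M] [Module.Finite R M] (hM : ∀ y ∈ powTorsion I M, y = 0) :
    ∃ x ∈ I, IsSMulRegular M x := by
  have : Subsingleton ((R ⧸ I) →ₗ[R] M) := by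
    refine ⟨fun φ ψ => ?_⟩
    have key : ∀ φ : (R ⧸ I) →ₗ[R] M, φ (Ideal.Quotient.mk I 1) = 0 := fun φ => by
      refine hM _ ⟨1, fun a ha => ?_⟩
      rw [pow_one] at ha
      rw [← map_smul]
      have : a • (Ideal.Quotient.mk I 1) = 0 := by
        rw [Algebra.smul_def, map_one, mul_one]
        exact Ideal.Quotient.eq_zero_iff_mem.2 ha
      rw [this, map_zero]
    refine Submodule.linearMap_qext _ (LinearMap.ext_ring ?_)
    exact (key φ).trans (key ψ).symm
  obtain ⟨r, hr, h⟩ := IsSMulRegular.subsingleton_linearMap_iff.1 this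
  exact ⟨r, by rwa [Ideal.annihilator_quotient] at hr, h⟩

namespace LC

lemma smul_map_eq_zero {M : Type u} [AddCommGroup M] [Module R M] {i : ℕ}
    (h : LC I (i + 1) (powTorsion I M)) [IsNoetherianRing R] : h = 0 :=
  eq_zero_of_torsion i _ (by
    rintro ⟨y, t, hy⟩
    exact ⟨t, fun a ha => Subtype.ext (hy a ha)⟩) h

lemma map_mkQ_powTorsion_bijective [IsNoetherianRing R] (M : Type u) [AddCommGroup M] [Module R M]
    (i : ℕ) : Function.Bijective (map I (i + 1) (powTorsion I M).mkQ) := by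
  have hf := (powTorsion I M).injective_subtype
  have hfg := LinearMap.exact_subtype_mkQ (powTorsion I M)
  have hg := (powTorsion I M).mkQ_surjective
  constructor
  · rw [injective_iff_map_eq_zero]
    intro a ha
    obtain ⟨b, rfl⟩ := (map_exact hf hfg hg I (i + 1) a).1 ha
    rw [smul_map_eq_zero b, map_zero]
  · intro a
    obtain ⟨δ, h1, h2⟩ := exists_connecting hf hfg hg I (i + 1)
    exact (h1 a).1 (smul_map_eq_zero _)

theorem finite_of_pow_smul_eq_zero [IsNoetherianRing R] : ∀ (i : ℕ) (M : Type u) [AddCommGroup M]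
    [Module R M] [Module.Finite R M],
    (∀ j ≤ i, ∃ N : ℕ, ∀ a ∈ I ^ N, ∀ h : LC I j M, a • h = 0) → Module.Finite R (LC I i M) := by
  intro i
  induction i with
  | zero =>
    intro M _ _ _ _
    exact Module.Finite.equiv (torsionEquiv I M)
  | succ i ih =>
    intro M _ _ _ hM
    let M' := M ⧸ powTorsion I M
    have hM' : ∀ j ≤ i + 1, ∃ N : ℕ, ∀ a ∈ I ^ N, ∀ h : LC I j M', a • h = 0 := by
      rintro (_ | j) hj
      · refine ⟨0, fun a _ h => ?_⟩
        obtain ⟨⟨y, hy⟩, rfl⟩ := (torsionEquiv I M').surjective h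
        obtain rfl := powTorsion_quotient_eq_bot I M y hy
        rw [← _root_.map_smul]
        convert _root_.map_zero (torsionEquiv I M')
        exact Subtype.ext (smul_zero a)
      · obtain ⟨N, hN⟩ := hM _ hj
        refine ⟨N, fun a ha h => ?_⟩
        obtain ⟨h, rfl⟩ := (map_mkQ_powTorsion_bijective M j).2 h
        rw [← _root_.map_smul, hN a ha, _root_.map_zero]
    obtain ⟨x, hxI, hx⟩ := exists_isSMulRegular_of_powTorsion_eq_bot (I := I) M'
      (powTorsion_quotient_eq_bot I M)
    obtain ⟨N, hN⟩ := hM' (i + 1) le_rfl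
    have hy : Function.Injective (LinearMap.lsmul R M' (x ^ N)) := hx.pow N
    have hfg := LinearMap.exact_map_mkQ_range (LinearMap.lsmul R M' (x ^ N))
    have hg := Submodule.mkQ_surjective (LinearMap.range (LinearMap.lsmul R M' (x ^ N)))
    have hQ : Module.Finite R (LC I i (M' ⧸ LinearMap.range (LinearMap.lsmul R M' (x ^ N)))) := by
      apply ih
      intro j hj
      obtain ⟨N₁, hN₁⟩ := hM' j (by omega)
      obtain ⟨N₂, hN₂⟩ := hM' (j + 1) (by omega)
      obtain ⟨δ, h1, h2⟩ := exists_connecting hy hfg hg I j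
      exact ⟨N₁ + N₂, pow_smul_eq_zero_of_exact h1 hN₁ hN₂⟩
    obtain ⟨δ, h1, h2⟩ := exists_connecting hy hfg hg I i
    have hδ : Function.Surjective δ := fun k =>
      (h2 k).1 (by rw [map_lsmul]; exact hN _ (Ideal.pow_mem_pow hxI N) k)
    have : Module.Finite R (LC I (i + 1) M') := Module.Finite.of_surjective δ hδ
    exact Module.Finite.equiv
      (LinearEquiv.ofBijective _ (map_mkQ_powTorsion_bijective (I := I) M i)).symm

end LC

end FiniteCriterion

section BaseChange

variable {A B : Type u} [CommRing A] [CommRing B] [Algebra A B]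

lemma exists_pow_smul_eq_pow_smul [IsNoetherianRing B] (E : Type u) [AddCommGroup E] [Module B E]
    [hE : Module.Injective B E] (x : B) (e : E) :
    ∃ (n : ℕ) (e' : E), x ^ n • (e - x • e') = 0 := by
  obtain ⟨n, hn⟩ := monotone_stabilizes_iff_noetherian.2 ‹IsNoetherianRing B›
    ⟨fun n => LinearMap.ker (LinearMap.lsmul B B (x ^ n)), monotone_nat_of_le_succ fun n b hb => by
      simp only [LinearMap.mem_ker, LinearMap.lsmul_apply, smul_eq_mul] at hb ⊢
      rw [pow_succ', mul_assoc, hb, mul_zero]⟩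
  have hn : LinearMap.ker (LinearMap.lsmul B B (x ^ n)) =
    LinearMap.ker (LinearMap.lsmul B B (x ^ (n + 1))) := hn (n + 1) (by omega)
  let φ := LinearMap.lsmul B B (x ^ (n + 1))
  obtain ⟨h, hh⟩ := hE.out ((LinearMap.ker φ).liftQ φ le_rfl)
    (by rw [← LinearMap.ker_eq_bot, Submodule.ker_liftQ_eq_bot' _ _ rfl])
    ((LinearMap.ker φ).liftQ (LinearMap.toSpanSingleton B E (x ^ n • e)) (by
      intro b hb
      have hb : b ∈ LinearMap.ker (LinearMap.lsmul B B (x ^ n)) := hn ▸ hb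
      simp only [LinearMap.mem_ker, LinearMap.lsmul_apply, smul_eq_mul] at hb
      rw [LinearMap.mem_ker, LinearMap.toSpanSingleton_apply, smul_smul, mul_comm, hb, zero_smul]))
  refine ⟨n, h 1, ?_⟩
  have h1 : h (x ^ (n + 1) * 1) = (1 : B) • x ^ n • e := hh (Submodule.Quotient.mk 1)
  rw [← smul_eq_mul, map_smul, one_smul] at h1
  rw [smul_sub, ← h1, smul_smul, pow_succ, sub_self]

lemma LC.eq_zero_of_injective_of_algebra [IsNoetherianRing A] [IsNoetherianRing B] (J : Ideal A)
    (i : ℕ) (T : Finset A) : ∀ (K : Ideal A) (_ : K ⊔ Ideal.span T = J) (E : Type u)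
    [AddCommGroup E] [Module A E] [Module B E] [IsScalarTower A B E] [Module.Injective B E]
    (_ : ∀ e : E, e ∈ powTorsion K E) (h : LC J (i + 1) E), h = 0 := by
  classical
  induction T using Finset.induction_on with
  | empty =>
    intro K hK E _ _ _ _ _ hE h
    rw [Finset.coe_empty, Ideal.span_empty, sup_bot_eq] at hK
    subst hK
    exact LC.eq_zero_of_torsion i E hE h
  | insert x T _ ih =>
    intro K hK E _ _ _ _ _ hE h
    let E' := powTorsion (Ideal.span {algebraMap A B x}) E
    have hmem : ∀ e : E, e ∈ E' ↔ ∃ n : ℕ, x ^ n • e = 0 := fun e => by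
      refine ⟨fun ⟨t, ht⟩ => ⟨t, ?_⟩, fun ⟨t, ht⟩ => ⟨t, fun a ha => ?_⟩⟩
      · have := ht _ (Ideal.pow_mem_pow (Ideal.mem_span_singleton_self _) t)
        rwa [← map_pow, algebraMap_smul] at this
      · rw [Ideal.span_singleton_pow, Ideal.mem_span_singleton'] at ha
        obtain ⟨b, rfl⟩ := ha
        rw [mul_smul, ← map_pow, algebraMap_smul, ht, smul_zero]
    have hf : Function.Injective (E'.subtype.restrictScalars A) := E'.injective_subtype
    have hfg : Function.Exact (E'.subtype.restrictScalars A) (E'.mkQ.restrictScalars A) :=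
      LinearMap.exact_subtype_mkQ E'
    have hg : Function.Surjective (E'.mkQ.restrictScalars A) := E'.mkQ_surjective
    have hbij : Function.Bijective fun y : E ⧸ E' => x • y := by
      constructor
      · intro y z hyz
        obtain ⟨y, rfl⟩ := hg y
        obtain ⟨z, rfl⟩ := hg z
        have : x • (y - z) ∈ E' := by
          have h0 : (E'.mkQ.restrictScalars A) (x • (y - z)) = 0 := by
            rw [map_smul, map_sub, smul_sub, sub_eq_zero]
            exact hyz
          rw [← Submodule.ker_mkQ E']
          exact h0
        obtain ⟨n, hn⟩ := (hmem _).1 this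
        have h2 : y - z ∈ E' := (hmem _).2 ⟨n + 1, by rw [pow_succ, mul_smul, hn]⟩
        rw [← sub_eq_zero, ← map_sub]
        rw [← Submodule.ker_mkQ E'] at h2
        exact h2
      · intro y
        obtain ⟨e, rfl⟩ := hg y
        obtain ⟨n, e', h⟩ := exists_pow_smul_eq_pow_smul E (algebraMap A B x) e
        rw [← map_pow, algebraMap_smul, algebraMap_smul] at h
        refine ⟨E'.mkQ.restrictScalars A e', ?_⟩
        have h2 : e - x • e' ∈ E' := (hmem _).2 ⟨n, h⟩
        rw [← Submodule.ker_mkQ E'] at h2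
        have h3 : (E'.mkQ.restrictScalars A) (e - x • e') = 0 := h2
        rw [map_sub, map_smul, sub_eq_zero] at h3
        exact h3.symm
    have hxJ : x ∈ J := hK ▸ Ideal.mem_sup_right (Ideal.subset_span (by simp))
    obtain ⟨k, rfl⟩ := (LC.map_exact hf hfg hg J (i + 1) h).1
      (LC.eq_zero_of_bijective x hxJ hbij _)
    rw [ih (K ⊔ Ideal.span {x}) ?_ E' ?_ k, map_zero]
    · rw [← hK, Finset.coe_insert, Ideal.span_insert, sup_assoc]
    · rintro ⟨e, he⟩
      obtain ⟨n, hn⟩ := (hmem e).1 he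
      obtain ⟨t, ht⟩ := hE e
      refine ⟨t + n, fun a ha => Subtype.ext ?_⟩
      have ha : a ∈ K ^ t ⊔ Ideal.span {x} ^ n := Ideal.sup_pow_add_le_pow_sup_pow ha
      obtain ⟨b, hb, c, hc, rfl⟩ := Submodule.mem_sup.1 ha
      rw [Ideal.span_singleton_pow, Ideal.mem_span_singleton'] at hc
      obtain ⟨d, rfl⟩ := hc
      change (b + d * x ^ n) • e = 0
      rw [add_smul, ht b hb, mul_smul, hn, smul_zero, add_zero]

end BaseChange

section BaseChangeTransfer

variable {A B : Type u} [CommRing A] [CommRing B] [Algebra A B]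

lemma mem_powTorsion_map_iff (hAB : Function.Surjective (algebraMap A B)) (J : Ideal A)
    {N : Type u} [AddCommGroup N] [Module A N] [Module B N] [IsScalarTower A B N] (y : N) :
    y ∈ powTorsion (J.map (algebraMap A B)) N ↔ y ∈ powTorsion J N := by
  refine exists_congr fun t => ?_
  rw [← Ideal.map_pow]
  refine ⟨fun h a ha => ?_, fun h b hb => ?_⟩
  · rw [← algebraMap_smul B a y]
    exact h _ (Ideal.mem_map_of_mem _ ha)
  · obtain ⟨a, ha, rfl⟩ := (Ideal.mem_map_iff_of_surjective _ hAB).1 hb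
    rw [algebraMap_smul, h a ha]

lemma LC.eq_zero_of_injective_of_surjective [IsNoetherianRing A] [IsNoetherianRing B]
    (J : Ideal A) (E : Type u) [AddCommGroup E] [Module A E] [Module B E] [IsScalarTower A B E]
    [Module.Injective B E] (i : ℕ) (h : LC J (i + 1) E) : h = 0 := by
  obtain ⟨T, hT⟩ := IsNoetherian.noetherian J
  refine LC.eq_zero_of_injective_of_algebra (B := B) J i T ⊥
    (by rw [bot_sup_eq]; exact hT) E (fun e => ⟨1, fun a ha => ?_⟩) h
  rw [pow_one, Ideal.mem_bot] at ha
  rw [ha, zero_smul]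

lemma LC.smul_eq_zero_map [IsNoetherianRing A] [IsNoetherianRing B]
    (hAB : Function.Surjective (algebraMap A B)) (J : Ideal A) (s : A) :
    ∀ (i : ℕ) (N : Type u) [AddCommGroup N] [Module A N] [Module B N] [IsScalarTower A B N]
    (_ : ∀ h : LC J i N, s • h = 0) (h : LC (J.map (algebraMap A B)) i N),
    algebraMap A B s • h = 0 := by
  intro i
  rcases i with _ | i
  · intro N _ _ _ _ hs h
    obtain ⟨⟨y, hy⟩, rfl⟩ := (LC.torsionEquiv _ N).surjective h
    have h1 := hs (LC.torsionEquiv J N ⟨y, (mem_powTorsion_map_iff hAB J y).1 hy⟩)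
    rw [← map_smul, LinearEquiv.map_eq_zero_iff] at h1
    rw [← map_smul, LinearEquiv.map_eq_zero_iff]
    refine Subtype.ext ?_
    rw [Submodule.coe_smul, algebraMap_smul]
    exact congr_arg Subtype.val h1
  induction i with
  | zero =>
    intro N _ _ _ _ hs h
    obtain ⟨E, _, _, f, hf, _⟩ := exists_injective_embedding (R := B) N
    let _ := Module.compHom E (algebraMap A B)
    have : IsScalarTower A B E := IsScalarTower.of_algebraMap_smul fun _ _ => rfl
    have hfg := LinearMap.exact_map_mkQ_range f
    have hg := Submodule.mkQ_surjective (LinearMap.range f)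
    obtain ⟨δ, h1, h2⟩ := LC.exists_connecting hf hfg hg (J.map (algebraMap A B)) 0
    obtain ⟨δ', h1', h2'⟩ := LC.exists_connecting (f := f.restrictScalars A)
      (g := (Submodule.mkQ (LinearMap.range f)).restrictScalars A) hf hfg hg J 0
    obtain ⟨k, rfl⟩ := LC.connecting_surjective h2 (fun h => LC.eq_zero_of_injective h) h
    obtain ⟨⟨y, hy⟩, rfl⟩ := (LC.torsionEquiv _ _).surjective k
    have hy' := (mem_powTorsion_map_iff hAB J y).1 hy
    have h3 := hs (δ' (LC.torsionEquiv J _ ⟨y, hy'⟩))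
    rw [← map_smul, ← map_smul] at h3
    obtain ⟨e, he⟩ := (h1' _).1 h3
    obtain ⟨⟨e, he'⟩, rfl⟩ := (LC.torsionEquiv _ _).surjective e
    rw [LC.map_torsionEquiv, (LC.torsionEquiv _ _).injective.eq_iff] at he
    have he := congr_arg Subtype.val he
    rw [← map_smul, ← map_smul, h1]
    refine ⟨LC.torsionEquiv _ _ ⟨e, (mem_powTorsion_map_iff hAB J e).2 he'⟩, ?_⟩
    rw [LC.map_torsionEquiv]
    congr 1
    refine Subtype.ext ?_
    rw [Submodule.coe_smul, algebraMap_smul]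
    exact he
  | succ i ih =>
    intro N _ _ _ _ hs h
    obtain ⟨E, _, _, f, hf, _⟩ := exists_injective_embedding (R := B) N
    let _ := Module.compHom E (algebraMap A B)
    have : IsScalarTower A B E := IsScalarTower.of_algebraMap_smul fun _ _ => rfl
    have hfg := LinearMap.exact_map_mkQ_range f
    have hg := Submodule.mkQ_surjective (LinearMap.range f)
    obtain ⟨δ, h1, h2⟩ := LC.exists_connecting hf hfg hg (J.map (algebraMap A B)) (i + 1)
    obtain ⟨δ', h1', h2'⟩ := LC.exists_connecting (f := f.restrictScalars A)
      (g := (Submodule.mkQ (LinearMap.range f)).restrictScalars A) hf hfg hg J (i + 1)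
    obtain ⟨k, rfl⟩ := LC.connecting_surjective h2 (fun h => LC.eq_zero_of_injective h) h
    rw [← map_smul, ih _ ?_ k, map_zero]
    intro k
    have h3 := hs (δ' k)
    rw [← map_smul] at h3
    obtain ⟨e, he⟩ := (h1' _).1 h3
    rw [← he, LC.eq_zero_of_injective_of_surjective (B := B) J E i e, map_zero]

lemma LC.smul_eq_zero_of_map [IsNoetherianRing A] [IsNoetherianRing B]
    (hAB : Function.Surjective (algebraMap A B)) (J : Ideal A) (s : A) :
    ∀ (i : ℕ) (N : Type u) [AddCommGroup N] [Module A N] [Module B N] [IsScalarTower A B N]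
    (_ : ∀ h : LC (J.map (algebraMap A B)) i N, algebraMap A B s • h = 0) (h : LC J i N),
    s • h = 0 := by
  intro i
  rcases i with _ | i
  · intro N _ _ _ _ hs h
    obtain ⟨⟨y, hy⟩, rfl⟩ := (LC.torsionEquiv _ N).surjective h
    have h1 := hs (LC.torsionEquiv _ N ⟨y, (mem_powTorsion_map_iff hAB J y).2 hy⟩)
    rw [← map_smul, LinearEquiv.map_eq_zero_iff] at h1
    rw [← map_smul, LinearEquiv.map_eq_zero_iff]
    refine Subtype.ext ?_
    rw [Submodule.coe_smul, ← algebraMap_smul B s]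
    exact congr_arg Subtype.val h1
  induction i with
  | zero =>
    intro N _ _ _ _ hs h
    obtain ⟨E, _, _, f, hf, _⟩ := exists_injective_embedding (R := B) N
    let _ := Module.compHom E (algebraMap A B)
    have : IsScalarTower A B E := IsScalarTower.of_algebraMap_smul fun _ _ => rfl
    have hfg := LinearMap.exact_map_mkQ_range f
    have hg := Submodule.mkQ_surjective (LinearMap.range f)
    obtain ⟨δ, h1, h2⟩ := LC.exists_connecting hf hfg hg (J.map (algebraMap A B)) 0
    obtain ⟨δ', h1', h2'⟩ := LC.exists_connecting (f := f.restrictScalars A)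
      (g := (Submodule.mkQ (LinearMap.range f)).restrictScalars A) hf hfg hg J 0
    obtain ⟨k, rfl⟩ := LC.connecting_surjective h2'
      (fun h => LC.eq_zero_of_injective_of_surjective (B := B) J E 0 h) h
    obtain ⟨⟨y, hy⟩, rfl⟩ := (LC.torsionEquiv _ _).surjective k
    have hy' := (mem_powTorsion_map_iff hAB J y).2 hy
    have h3 := hs (δ (LC.torsionEquiv _ _ ⟨y, hy'⟩))
    rw [← map_smul, ← map_smul] at h3
    obtain ⟨e, he⟩ := (h1 _).1 h3
    obtain ⟨⟨e, he'⟩, rfl⟩ := (LC.torsionEquiv _ _).surjective e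
    rw [LC.map_torsionEquiv, (LC.torsionEquiv _ _).injective.eq_iff] at he
    have he := congr_arg Subtype.val he
    rw [← map_smul, ← map_smul, h1']
    refine ⟨LC.torsionEquiv _ _ ⟨e, (mem_powTorsion_map_iff hAB J e).1 he'⟩, ?_⟩
    rw [LC.map_torsionEquiv]
    congr 1
    refine Subtype.ext ?_
    rw [Submodule.coe_smul, ← algebraMap_smul B s]
    exact he
  | succ i ih =>
    intro N _ _ _ _ hs h
    obtain ⟨E, _, _, f, hf, _⟩ := exists_injective_embedding (R := B) N
    let _ := Module.compHom E (algebraMap A B)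
    have : IsScalarTower A B E := IsScalarTower.of_algebraMap_smul fun _ _ => rfl
    have hfg := LinearMap.exact_map_mkQ_range f
    have hg := Submodule.mkQ_surjective (LinearMap.range f)
    obtain ⟨δ, h1, h2⟩ := LC.exists_connecting hf hfg hg (J.map (algebraMap A B)) (i + 1)
    obtain ⟨δ', h1', h2'⟩ := LC.exists_connecting (f := f.restrictScalars A)
      (g := (Submodule.mkQ (LinearMap.range f)).restrictScalars A) hf hfg hg J (i + 1)
    obtain ⟨k, rfl⟩ := LC.connecting_surjective h2'
      (fun h => LC.eq_zero_of_injective_of_surjective (B := B) J E _ h) h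
    rw [← map_smul, ih _ ?_ k, map_zero]
    intro k
    have h3 := hs (δ k)
    rw [← map_smul] at h3
    obtain ⟨e, he⟩ := (h1 _).1 h3
    rw [← he, LC.eq_zero_of_injective e, map_zero]

end BaseChangeTransfer

section Depth

open RingTheory.Sequence IsLocalRing
open scoped Pointwise

variable {S : Type u} [CommRing S]

/-- `DepthGE J d N` says that `J` contains a weakly `N`-regular sequence of length `d`. -/
def DepthGE (J : Ideal S) (d : ℕ) (N : Type u) [AddCommGroup N] [Module S N] : Prop :=
  ∃ rs : List S, rs.length = d ∧ (∀ r ∈ rs, r ∈ J) ∧ IsWeaklyRegular N rs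

lemma DepthGE.zero (J : Ideal S) (N : Type u) [AddCommGroup N] [Module S N] : DepthGE J 0 N :=
  ⟨[], rfl, by simp, by simp⟩

lemma depthGE_succ_iff {J : Ideal S} {d : ℕ} {N : Type u} [AddCommGroup N] [Module S N] :
    DepthGE J (d + 1) N ↔ ∃ x ∈ J, IsSMulRegular N x ∧ DepthGE J d (QuotSMulTop x N) := by
  constructor
  · rintro ⟨_ | ⟨x, rs⟩, hl, hm, hr⟩
    · simp at hl
    · rw [isWeaklyRegular_cons_iff] at hr
      exact ⟨x, hm x (by simp), hr.1, rs, by simpa using hl,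
        fun r h => hm r (by simp [h]), hr.2⟩
  · rintro ⟨x, hx, hreg, rs, hl, hm, hr⟩
    refine ⟨x :: rs, by simp [hl], ?_, (isWeaklyRegular_cons_iff _ _ _).2 ⟨hreg, hr⟩⟩
    intro r h
    rcases List.mem_cons.1 h with rfl | h
    exacts [hx, hm r h]

lemma DepthGE.congr {J : Ideal S} {d : ℕ} {N N' : Type u} [AddCommGroup N] [Module S N]
    [AddCommGroup N'] [Module S N'] (e : N ≃ₗ[S] N') (h : DepthGE J d N) : DepthGE J d N' := by
  obtain ⟨rs, hl, hm, hr⟩ := h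
  exact ⟨rs, hl, hm, (e.isWeaklyRegular_congr rs).1 hr⟩

lemma DepthGE.mono {J : Ideal S} {d e : ℕ} (hde : d ≤ e) {N : Type u} [AddCommGroup N]
    [Module S N] (h : DepthGE J e N) : DepthGE J d N := by
  induction d generalizing e N with
  | zero => exact .zero J N
  | succ d ih =>
    obtain ⟨e, rfl⟩ := Nat.exists_eq_add_of_le' (show 1 ≤ e by omega)
    obtain ⟨x, hx, hr, h⟩ := depthGE_succ_iff.1 h
    exact depthGE_succ_iff.2 ⟨x, hx, hr, ih (by omega) h⟩

lemma DepthGE.of_subsingleton (J : Ideal S) (d : ℕ) (N : Type u) [AddCommGroup N] [Module S N]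
    [Subsingleton N] : DepthGE J d N := by
  induction d generalizing N with
  | zero => exact .zero J N
  | succ d ih =>
    have : Subsingleton (QuotSMulTop (0 : S) N) := inferInstanceAs (Subsingleton (N ⧸ _))
    exact depthGE_succ_iff.2 ⟨0, J.zero_mem, fun _ _ _ => Subsingleton.elim _ _, ih _⟩

lemma ringKrullDim_quotient_mono {p q : Ideal S} (h : p ≤ q) :
    ringKrullDim (S ⧸ q) ≤ ringKrullDim (S ⧸ p) :=
  ringKrullDim_le_of_surjective (Ideal.Quotient.factor h) (Ideal.Quotient.factor_surjective h)

lemma ringKrullDim_quotient_succ_le {p q : Ideal S} [p.IsPrime] (h : p < q) :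
    ringKrullDim (S ⧸ q) + 1 ≤ ringKrullDim (S ⧸ p) := by
  obtain ⟨hle, x, hxq, hxp⟩ := SetLike.lt_iff_le_and_exists.1 h
  refine ringKrullDim_succ_le_of_surjective (Ideal.Quotient.factor hle)
    (Ideal.Quotient.factor_surjective hle) (r := Ideal.Quotient.mk p x) ?_ ?_
  · rw [mem_nonZeroDivisors_iff_ne_zero]
    rwa [Ne, Ideal.Quotient.eq_zero_iff_mem]
  · simpa [Ideal.Quotient.eq_zero_iff_mem] using hxq

variable [IsNoetherianRing S]

open Abelian in
/-- Cutting by a regular element lowers the depth by at most one. -/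
lemma DepthGE.quotSMulTop [IsLocalRing S] {d : ℕ} {N : Type u} [AddCommGroup N] [Module S N]
    [Module.Finite S N] (h : DepthGE (maximalIdeal S) (d + 1) N) {y : S}
    (hy : y ∈ maximalIdeal S) (hreg : IsSMulRegular N y) :
    DepthGE (maximalIdeal S) d (QuotSMulTop y N) := by
  rcases subsingleton_or_nontrivial N with hN | hN
  · have : Subsingleton (QuotSMulTop y N) := inferInstanceAs (Subsingleton (N ⧸ _))
    exact .of_subsingleton _ _ _
  have hlt : ∀ (X : Type u) [AddCommGroup X] [Module S X] [Module.Finite S X] [Nontrivial X],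
      maximalIdeal S • (⊤ : Submodule S X) < ⊤ := fun X _ _ _ _ =>
    (Submodule.top_ne_ideal_smul_of_le_jacobson_annihilator
      (maximalIdeal_le_jacobson _)).symm.lt_top
  obtain ⟨rs, hl, hm, hr⟩ := h
  have hr := IsRegular.of_isWeaklyRegular_of_mem_maximalIdeal N hm hr
  let K := ModuleCat.of S (S ⧸ maximalIdeal S)
  have hK : Module.support S K = PrimeSpectrum.zeroLocus (maximalIdeal S) := by
    rw [Module.support_eq_zeroLocus, Ideal.annihilator_quotient]
  have hE : ∀ i < d + 1, Subsingleton (Ext K (ModuleCat.of S N) i) := fun i hi =>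
    ModuleCat.subsingleton_ext_of_exists_isRegular (maximalIdeal S) K hK.le (ModuleCat.of S N)
      (hlt N) rs hm hr i (by omega)
  have : Nontrivial (QuotSMulTop y N) := nontrivial_quotSMulTop_of_mem_maximalIdeal N hy
  have : Module.Finite S (QuotSMulTop y N) := inferInstanceAs (Module.Finite S (N ⧸ _))
  obtain ⟨rs', hl', hm', hr'⟩ :=
    ModuleCat.exists_isRegular_of_exists_subsingleton_ext (maximalIdeal S) d
      (ModuleCat.of S (QuotSMulTop y N)) (hlt _) K hK fun i hi => by
        have hreg' : IsSMulRegular (ModuleCat.of S N) y := hreg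
        have zero1 := AddCommGrpCat.isZero_of_iff_subsingleton.mpr (hE i (by omega))
        have zero2 := AddCommGrpCat.isZero_of_iff_subsingleton.mpr (hE (i + 1) (by omega))
        exact AddCommGrpCat.subsingleton_of_isZero <| ShortComplex.Exact.isZero_of_both_zeros
          ((Ext.covariant_sequence_exact₃' K hreg'.smulShortComplex_shortExact) i (i + 1) rfl)
          (zero1.eq_zero_of_src _) (zero2.eq_zero_of_tgt _)
  exact ⟨rs', hl', hm', hr'.1⟩

/-- An associated prime of `A` contained in a prime `Q` specialises, inside `Q`, to an
associated prime of `A / zA` for every `A`-regular `z ∈ Q`. -/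
lemma exists_mem_associatedPrimes_quotSMulTop {A : Type u} [AddCommGroup A] [Module S A]
    [Module.Finite S A] {Q₀ Q : Ideal S} (hQ₀ : Q₀ ∈ associatedPrimes S A) [hQ : Q.IsPrime]
    (hle : Q₀ ≤ Q) {z : S} (hz : z ∈ Q) (hreg : IsSMulRegular A z) :
    ∃ Q₁ ∈ associatedPrimes S (QuotSMulTop z A), Q₀ ≤ Q₁ ∧ Q₁ ≤ Q ∧ z ∈ Q₁ := by
  let X : Submodule S A := Submodule.torsionBySet S A Q₀
  have hinj : Function.Injective (QuotSMulTop.map z X.subtype) := by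
    rw [injective_iff_map_eq_zero]
    intro a ha
    obtain ⟨a, rfl⟩ := Submodule.Quotient.mk_surjective _ a
    rw [QuotSMulTop.map_apply_mk, Submodule.Quotient.mk_eq_zero,
      Submodule.mem_smul_pointwise_iff_exists] at ha
    obtain ⟨b, -, hb⟩ := ha
    have hbX : b ∈ X := by
      rw [Submodule.mem_torsionBySet_iff]
      intro q
      apply hreg
      have := (Submodule.mem_torsionBySet_iff _ _).1 a.2 q
      simp only [Submodule.subtype_apply] at hb
      rw [← hb] at this
      simpa [smul_comm z] using this
    rw [Submodule.Quotient.mk_eq_zero, Submodule.mem_smul_pointwise_iff_exists]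
    exact ⟨⟨b, hbX⟩, trivial, Subtype.ext hb⟩
  have hQX : (⟨Q, hQ⟩ : PrimeSpectrum S) ∈ Module.support S (QuotSMulTop z X) := by
    rw [Module.support_quotSMulTop]
    refine ⟨?_, by simpa using hz⟩
    rw [Module.mem_support_iff_of_finite]
    obtain ⟨hp, x, hx⟩ := isAssociatedPrime_iff.1 hQ₀
    intro a ha
    apply hle
    have hxX : x ∈ X := by
      rw [Submodule.mem_torsionBySet_iff]
      intro q
      simpa [Submodule.mem_colon_singleton] using hx.le q.2
    rw [hx]
    simpa [Submodule.mem_colon_singleton] using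
      congrArg Subtype.val (Module.mem_annihilator.1 ha ⟨x, hxX⟩)
  rw [Module.mem_support_iff_of_finite] at hQX
  obtain ⟨Q₁, hQ₁, hQ₁Q⟩ := Ideal.exists_minimalPrimes_le hQX
  have : Module.Finite S (QuotSMulTop z X) := inferInstanceAs (Module.Finite S (X ⧸ _))
  have hann := hQ₁.1.2
  refine ⟨Q₁, associatedPrimes.subset_of_injective hinj
    (Module.associatedPrimes.minimalPrimes_annihilator_subset_associatedPrimes _ _ hQ₁),
    fun q hq => hann ?_, hQ₁Q, hann (QuotSMulTop.mem_annihilator _ _)⟩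
  rw [Module.mem_annihilator]
  intro a
  obtain ⟨a, rfl⟩ := Submodule.Quotient.mk_surjective _ a
  have : q • a = 0 := Subtype.ext (by
    simpa using (Submodule.mem_torsionBySet_iff _ _).1 a.2 ⟨q, hq⟩)
  rw [← Submodule.Quotient.mk_smul, this, Submodule.Quotient.mk_zero]

lemma notMem_of_mem_associatedPrimes {A : Type u} [AddCommGroup A] [Module S A] {Q : Ideal S}
    (hQ : Q ∈ associatedPrimes S A) {z : S} (hreg : IsSMulRegular A z) : z ∉ Q := by
  obtain ⟨hp, x, hx⟩ := isAssociatedPrime_iff.1 hQ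
  intro hz
  rw [hx] at hz
  have hx0 : x = 0 := hreg (by simpa [Submodule.mem_colon_singleton] using hz)
  apply hp.ne_top
  rw [hx, hx0]
  ext
  simp [Submodule.mem_colon_singleton]

lemma exists_isSMulRegular_or_le_associatedPrime (A : Type u) [AddCommGroup A] [Module S A]
    [Module.Finite S A] (J : Ideal S) :
    (∃ y ∈ J, IsSMulRegular A y) ∨ ∃ q ∈ associatedPrimes S A, J ≤ q := by
  by_contra! h
  obtain ⟨h1, h2⟩ := h
  have hfin := associatedPrimes.finite S A
  have := (Ideal.subset_union_prime (s := hfin.toFinset) (f := id) ⊥ ⊥ (I := J)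
    fun i hi _ _ => ((hfin.mem_toFinset.1 hi).1)).1 (by
      intro y hy
      have h3 := h1 y hy
      have h4 : y ∈ ({r : S | IsSMulRegular A r} : Set S)ᶜ := h3
      rw [← biUnion_associatedPrimes_eq_compl_regular] at h4
      simpa using h4)
  obtain ⟨q, hq, hJ⟩ := this
  exact h2 q (hfin.mem_toFinset.1 hq) hJ

lemma DepthGE.le_ringKrullDim_of_mem_associatedPrimes [IsLocalRing S] {d : ℕ} {N : Type u}
    [AddCommGroup N] [Module S N] [Module.Finite S N] (h : DepthGE (maximalIdeal S) d N)
    {q : Ideal S} (hq : q ∈ associatedPrimes S N) : (d : WithBot ℕ∞) ≤ ringKrullDim (S ⧸ q) := by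
  have := hq.1
  induction d generalizing N q with
  | zero => exact mod_cast ringKrullDim_nonneg_of_nontrivial
  | succ d ih =>
    obtain ⟨x, hx, hreg, h⟩ := depthGE_succ_iff.1 h
    obtain ⟨q₁, hq₁, hle, -, hxq⟩ := exists_mem_associatedPrimes_quotSMulTop hq
      (le_maximalIdeal hq.1.ne_top) hx hreg
    have : Module.Finite S (QuotSMulTop x N) := inferInstanceAs (Module.Finite S (N ⧸ _))
    have hlt : q < q₁ := lt_of_le_of_ne hle fun e =>
      notMem_of_mem_associatedPrimes hq hreg (e ▸ hxq)
    calc ((d + 1 : ℕ) : WithBot ℕ∞) = (d : WithBot ℕ∞) + 1 := by push_cast; rfl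
      _ ≤ ringKrullDim (S ⧸ q₁) + 1 := by gcongr; exact ih h hq₁ hq₁.1
      _ ≤ _ := ringKrullDim_quotient_succ_le hlt

/-- The grade of a proper ideal `J` on `A` is at least `depth A - dim S/J`. -/
lemma DepthGE.exists_ideal [IsLocalRing S] {d : ℕ} {A : Type u} [AddCommGroup A] [Module S A]
    [Module.Finite S A] (h : DepthGE (maximalIdeal S) d A) {J : Ideal S} (hJ : J ≠ ⊤) :
    ∃ k : ℕ, DepthGE J k A ∧ (d : WithBot ℕ∞) ≤ k + ringKrullDim (S ⧸ J) := by
  induction d generalizing A with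
  | zero =>
    have : Nontrivial (S ⧸ J) := Ideal.Quotient.nontrivial_iff.2 hJ
    exact ⟨0, .zero _ _, by simpa using ringKrullDim_nonneg_of_nontrivial⟩
  | succ d ih =>
    rcases exists_isSMulRegular_or_le_associatedPrime A J with ⟨y, hy, hreg⟩ | ⟨q, hq, hle⟩
    · have : Module.Finite S (QuotSMulTop y A) := inferInstanceAs (Module.Finite S (A ⧸ _))
      obtain ⟨k, hk, hd⟩ := ih (h.quotSMulTop (le_maximalIdeal hJ hy) hreg)
      refine ⟨k + 1, depthGE_succ_iff.2 ⟨y, hy, hreg, hk⟩, ?_⟩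
      push_cast
      rw [add_right_comm]
      gcongr
    · refine ⟨0, .zero _ _, ?_⟩
      simpa using (h.le_ringKrullDim_of_mem_associatedPrimes hq).trans
        (ringKrullDim_quotient_mono hle)

end Depth

section Chains

open RingTheory.Sequence IsLocalRing
open scoped Pointwise

variable {S : Type u} [CommRing S]

lemma ringKrullDim_quotient_le_supportDim {A : Type u} [AddCommGroup A] [Module S A]
    [Module.Finite S A] {P : PrimeSpectrum S} (hP : P ∈ Module.support S A) :
    ringKrullDim (S ⧸ P.asIdeal) ≤ Module.supportDim S A := by
  rw [Module.supportDim_eq_ringKrullDim_quotient_annihilator]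
  exact ringKrullDim_quotient_mono (Module.mem_support_iff_of_finite.1 hP)

variable [IsNoetherianRing S]

lemma exists_natCast_eq_ringKrullDim_quotient [IsLocalRing S] {J : Ideal S} (hJ : J ≠ ⊤) :
    ∃ d : ℕ, ringKrullDim (S ⧸ J) = d := by
  have : Nontrivial (S ⧸ J) := Ideal.Quotient.nontrivial_iff.2 hJ
  have : IsLocalRing (S ⧸ J) :=
    .of_surjective' (Ideal.Quotient.mk J) Ideal.Quotient.mk_surjective
  have h1 : ringKrullDim (S ⧸ J) ≠ ⊤ := ringKrullDim_ne_top
  have h2 : ringKrullDim (S ⧸ J) ≠ ⊥ := ringKrullDim_ne_bot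
  obtain ⟨a, ha⟩ := WithBot.ne_bot_iff_exists.1 h2
  rw [← ha] at h1 ⊢
  have h3 : a ≠ ⊤ := by
    rintro rfl
    exact h1 rfl
  obtain ⟨n, hn⟩ := ENat.ne_top_iff_exists.1 h3
  exact ⟨n, by rw [← hn]; rfl⟩

lemma DepthGE.exists_module_of_le [IsLocalRing S] {P : PrimeSpectrum S} {d : ℕ} {A : Type u}
    [AddCommGroup A] [Module S A] [Module.Finite S A] (h : DepthGE (maximalIdeal S) d A)
    (hd : Module.supportDim S A ≤ d) (hP : P ∈ Module.support S A)
    (hq : ∃ q ∈ associatedPrimes S A, P.asIdeal ≤ q) :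
    ∃ (A' : Type u) (_ : AddCommGroup A') (_ : Module S A') (_ : Module.Finite S A') (e : ℕ),
      P.asIdeal ∈ associatedPrimes S A' ∧
      (∀ q ∈ Module.support S A', q.asIdeal ≤ P.asIdeal → q.asIdeal = P.asIdeal) ∧
      DepthGE (maximalIdeal S) e A' ∧ ringKrullDim (S ⧸ P.asIdeal) = e := by
  obtain ⟨q, hq, hPq⟩ := hq
  have hU := h.le_ringKrullDim_of_mem_associatedPrimes hq
  have hPd := (ringKrullDim_quotient_le_supportDim hP).trans hd
  have hlt : ∀ Q : Ideal S, Q.IsPrime → ringKrullDim (S ⧸ Q) ≤ d →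
      ∀ Q' : Ideal S, (d : WithBot ℕ∞) ≤ ringKrullDim (S ⧸ Q') → Q ≤ Q' → Q = Q' := by
    intro Q hQ hQd Q' hQ' hle
    by_contra hne
    have h1 := (add_le_add_left hQ' 1).trans
      ((ringKrullDim_quotient_succ_le (lt_of_le_of_ne hle hne)).trans hQd)
    have h2 : ((d + 1 : ℕ) : WithBot ℕ∞) ≤ d := by exact_mod_cast h1
    have h3 : d + 1 ≤ d := by exact_mod_cast h2
    omega
  obtain rfl := hlt _ P.2 hPd q hU hPq
  exact ⟨A, _, _, inferInstance, d, hq, fun q' hq' hle =>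
    hlt _ q'.2 ((ringKrullDim_quotient_le_supportDim hq').trans hd) _ hU hle, h, le_antisymm hPd hU⟩

/-- Starting from a module of depth at least its dimension, every prime of the support is a
minimal associated prime of a module whose depth is the dimension of that prime. -/
lemma DepthGE.exists_module [IsLocalRing S] {P : PrimeSpectrum S} {d : ℕ} {A : Type u}
    [AddCommGroup A] [Module S A] [Module.Finite S A] (h : DepthGE (maximalIdeal S) d A)
    (hd : Module.supportDim S A ≤ d) (hP : P ∈ Module.support S A) :
    ∃ (A' : Type u) (_ : AddCommGroup A') (_ : Module S A') (_ : Module.Finite S A') (e : ℕ),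
      P.asIdeal ∈ associatedPrimes S A' ∧
      (∀ q ∈ Module.support S A', q.asIdeal ≤ P.asIdeal → q.asIdeal = P.asIdeal) ∧
      DepthGE (maximalIdeal S) e A' ∧ ringKrullDim (S ⧸ P.asIdeal) = e := by
  induction d generalizing A with
  | zero =>
    rcases exists_isSMulRegular_or_le_associatedPrime A P.asIdeal with ⟨y, hy, hreg⟩ | hq
    · have hyP : P ∈ Module.support S (QuotSMulTop y A) := by
        rw [Module.support_quotSMulTop]
        exact ⟨hP, by simpa using hy⟩
      have : Module.Finite S (QuotSMulTop y A) := inferInstanceAs (Module.Finite S (A ⧸ _))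
      have h1 := Module.supportDim_quotSMulTop_succ_eq_supportDim hreg
        (le_maximalIdeal P.2.ne_top hy)
      obtain ⟨n, hn⟩ := exists_natCast_eq_ringKrullDim_quotient P.2.ne_top
      have h2 := ringKrullDim_quotient_le_supportDim hyP
      have h3 : ((n + 1 : ℕ) : WithBot ℕ∞) ≤ (0 : ℕ) := by
        refine le_trans ?_ hd
        rw [← h1]
        push_cast
        gcongr
        rwa [hn] at h2
      simp at h3
    · exact h.exists_module_of_le hd hP hq
  | succ d ih =>
    rcases exists_isSMulRegular_or_le_associatedPrime A P.asIdeal with ⟨y, hy, hreg⟩ | hq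
    · have hyP : P ∈ Module.support S (QuotSMulTop y A) := by
        rw [Module.support_quotSMulTop]
        exact ⟨hP, by simpa using hy⟩
      have : Module.Finite S (QuotSMulTop y A) := inferInstanceAs (Module.Finite S (A ⧸ _))
      have hym := le_maximalIdeal P.2.ne_top hy
      have h1 := Module.supportDim_quotSMulTop_succ_eq_supportDim hreg hym
      refine ih (h.quotSMulTop hym hreg) ?_ hyP
      rw [← h1] at hd
      push_cast at hd
      exact ENat.WithBot.add_le_add_one_right_iff.1 hd
    · exact h.exists_module_of_le hd hP hq

/-- Let `Q₀ ≤ Q` be primes of a Cohen-Macaulay local ring with `Q` minimal over `Q₀ + (y)`. Then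
`dim S/Q₀ ≤ dim S/Q + 1`. -/
lemma ringKrullDim_quotient_le_succ [IsLocalRing S] {D : ℕ} (hD : DepthGE (maximalIdeal S) D S)
    (hdim : ringKrullDim S = D) {Q₀ Q : Ideal S} [hQ₀ : Q₀.IsPrime] [hQ : Q.IsPrime]
    (hle : Q₀ ≤ Q) {y : S} (hy : y ∈ Q)
    (hmin : ∀ Q' : Ideal S, Q'.IsPrime → Q₀ ≤ Q' → Q' ≤ Q → y ∈ Q' → Q' = Q) :
    ringKrullDim (S ⧸ Q₀) ≤ ringKrullDim (S ⧸ Q) + 1 := by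
  have hnt : Nontrivial (S ⧸ Q) := Ideal.Quotient.nontrivial_iff.2 hQ.ne_top
  obtain ⟨A, _, _, _, e, hass, -, hdep, he⟩ := hD.exists_module (P := ⟨Q₀, hQ₀⟩)
    (by rw [Module.supportDim_self_eq_ringKrullDim, hdim])
    (Module.mem_support_iff_of_finite.2 fun a ha => by
      have : a = 0 := by simpa using Module.mem_annihilator.1 ha 1
      simp [this])
  simp only at hass he
  rw [he]
  rcases exists_isSMulRegular_or_le_associatedPrime A Q with ⟨z, hz, hreg⟩ | ⟨q, hq, hQq⟩
  · obtain _ | e := e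
    · have : (0 : WithBot ℕ∞) ≤ ringKrullDim (S ⧸ Q) := ringKrullDim_nonneg_of_nontrivial
      exact le_trans (by simp) (add_le_add_left this 1)
    · obtain ⟨Q₁, hQ₁, h01, h1Q, hz1⟩ := exists_mem_associatedPrimes_quotSMulTop hass hle hz hreg
      have : Module.Finite S (QuotSMulTop z A) := inferInstanceAs (Module.Finite S (A ⧸ _))
      have hU := (hdep.quotSMulTop (le_maximalIdeal hQ.ne_top hz)
        hreg).le_ringKrullDim_of_mem_associatedPrimes hQ₁
      have := hQ₁.1
      obtain rfl : Q₁ = Q := by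
        by_contra hne
        have hlt := lt_of_le_of_ne h1Q hne
        have := (Ideal.mem_minimalPrimes_span_of_mem_minimalPrimes_span_insert hlt y Q₀
          ⟨⟨hQ, Ideal.span_le.2 (Set.insert_subset hy hle)⟩, fun Q' hQ' hQ'Q =>
            (hmin Q' hQ'.1 (fun a ha => hQ'.2 (Ideal.subset_span (Or.inr ha))) hQ'Q
              (hQ'.2 (Ideal.subset_span (Or.inl rfl)))).ge⟩ Q₀ h01
          fun a ha => Ideal.le_radical (Ideal.subset_span (Or.inr ha))).2 ⟨hQ₀, (Ideal.span_eq Q₀).le⟩ h01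
        exact notMem_of_mem_associatedPrimes hass hreg (this hz1)
      push_cast
      gcongr
  · refine (hdep.le_ringKrullDim_of_mem_associatedPrimes hq).trans
      ((ringKrullDim_quotient_mono hQq).trans ?_)
    exact le_add_of_nonneg_right zero_le_one

end Chains

section Killed

open IsLocalRing
open scoped Pointwise

variable {R : Type u} [CommRing R]

/-- Some element outside `p` kills `X`. -/
def KilledOutside (p : Ideal R) (X : Type u) [AddCommGroup X] [Module R X] : Prop :=
  ∃ s ∉ p, ∀ x : X, s • x = 0

variable {p : Ideal R} {X Y Z : Type u} [AddCommGroup X] [Module R X] [AddCommGroup Y]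
  [Module R Y] [AddCommGroup Z] [Module R Z]

lemma KilledOutside.of_forall_eq_zero [hp : p.IsPrime] (h : ∀ x : X, x = 0) :
    KilledOutside p X :=
  ⟨1, (Ideal.ne_top_iff_one p).1 hp.ne_top, fun x => by rw [h x, smul_zero]⟩

lemma KilledOutside.of_exact [hp : p.IsPrime] {f : X →ₗ[R] Y} {g : Y →ₗ[R] Z}
    (hfg : Function.Exact f g) (hX : KilledOutside p X) (hZ : KilledOutside p Z) :
    KilledOutside p Y := by
  obtain ⟨s, hs, hsX⟩ := hX
  obtain ⟨t, ht, htZ⟩ := hZ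
  refine ⟨s * t, fun h => (hp.mem_or_mem h).elim hs ht, fun y => ?_⟩
  obtain ⟨x, hx⟩ := (hfg (t • y)).1 (by rw [map_smul, htZ])
  rw [mul_smul, ← hx, ← map_smul, hsX, map_zero]

lemma KilledOutside.of_injective {f : X →ₗ[R] Y} (hf : Function.Injective f)
    (hY : KilledOutside p Y) : KilledOutside p X := by
  obtain ⟨s, hs, hsY⟩ := hY
  exact ⟨s, hs, fun x => hf (by rw [map_smul, hsY, map_zero])⟩

lemma KilledOutside.of_surjective {f : X →ₗ[R] Y} (hf : Function.Surjective f)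
    (hX : KilledOutside p X) : KilledOutside p Y := by
  obtain ⟨s, hs, hsX⟩ := hX
  refine ⟨s, hs, fun y => ?_⟩
  obtain ⟨x, rfl⟩ := hf y
  rw [← map_smul, hsX, map_zero]

lemma KilledOutside.localCohomology (h : KilledOutside p X) (J : Ideal R) (i : ℕ) :
    KilledOutside p (LC J i X) := by
  obtain ⟨s, hs, hX⟩ := h
  exact ⟨s, hs, fun h => LC.smul_eq_zero_of_smul_eq_zero s hX h⟩

lemma killedOutside_of_notMem_support [Module.Finite R X] [hp : p.IsPrime]
    (h : (⟨p, hp⟩ : PrimeSpectrum R) ∉ Module.support R X) : KilledOutside p X := by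
  rw [Module.mem_support_iff_of_finite] at h
  obtain ⟨s, hs, hsp⟩ := SetLike.not_le_iff_exists.1 h
  exact ⟨s, hsp, Module.mem_annihilator.1 hs⟩

lemma exact_lsmul_mkQ (y : R) (N : Type u) [AddCommGroup N] [Module R N] :
    Function.Exact (LinearMap.lsmul R N y) (Submodule.mkQ (y • (⊤ : Submodule R N))) := by
  intro n
  rw [Submodule.mkQ_apply, Submodule.Quotient.mk_eq_zero,
    Submodule.mem_smul_pointwise_iff_exists]
  simp

variable [IsNoetherianRing R]

lemma KilledOutside.localCohomology_of_minimal [hp : p.IsPrime] {J : Ideal R} {i : ℕ}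
    (h : KilledOutside p (LC J i (R ⧸ p))) (N : Type u) [AddCommGroup N] [Module R N]
    [hN : Module.Finite R N]
    (hmin : ∀ q ∈ Module.support R N, q.asIdeal ≤ p → q.asIdeal = p) :
    KilledOutside p (LC J i N) := by
  induction hN using IsNoetherianRing.induction_on_isQuotientEquivQuotientPrime R with
  | subsingleton N =>
    exact KilledOutside.localCohomology (.of_forall_eq_zero fun x => Subsingleton.elim _ _) J i
  | quotient N q e =>
    by_cases hqp : q.asIdeal ≤ p
    · obtain rfl := hmin q (Module.mem_support_iff_of_finite.2 (by
        rw [e.annihilator_eq, Ideal.annihilator_quotient])) hqp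
      exact h.of_injective (LC.map_bijective e).1
    · obtain ⟨s, hs, hsp⟩ := SetLike.not_le_iff_exists.1 hqp
      refine KilledOutside.localCohomology ⟨s, hsp, fun x => e.injective ?_⟩ J i
      rw [map_smul, map_zero]
      obtain ⟨a, ha⟩ := Ideal.Quotient.mk_surjective (e x)
      rw [← ha, ← Ideal.Quotient.mk_eq_mk, ← Submodule.Quotient.mk_smul,
        Submodule.Quotient.mk_eq_zero]
      exact q.asIdeal.mul_mem_right _ hs
  | exact N₁ N₂ N₃ f g hf hg hfg h₁ h₃ =>
    exact .of_exact (LC.map_exact hf hfg hg J i)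
      (h₁ fun q hq => hmin q (Module.support_subset_of_injective f hf hq))
      (h₃ fun q hq => hmin q (Module.support_subset_of_surjective g hg hq))

omit [IsNoetherianRing R] in
lemma LC.eq_zero_of_depthGE {J : Ideal R} {k : ℕ} {A : Type u} [AddCommGroup A] [Module R A]
    (hA : DepthGE J k A) {i : ℕ} (hi : i < k) (h : LC J i A) : h = 0 := by
  induction k generalizing A i with
  | zero => omega
  | succ k ih =>
    obtain ⟨x, hx, hreg, hk⟩ := depthGE_succ_iff.1 hA
    have hf : Function.Injective (LinearMap.lsmul R A x) := hreg
    have hinj : Function.Injective (LC.map J i (LinearMap.lsmul R A x)) := by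
      rcases i with _ | i
      · exact LC.map_zero_injective hf
      · obtain ⟨δ, -, h2⟩ := LC.exists_connecting hf (exact_lsmul_mkQ x A)
          (Submodule.mkQ_surjective _) J i
        rw [injective_iff_map_eq_zero]
        intro a ha
        obtain ⟨b, rfl⟩ := (h2 a).1 ha
        rw [show b = 0 from ih hk (by omega) b, map_zero]
    obtain ⟨t, ht⟩ := LC.exists_pow_smul_eq_zero i A h
    replace ht := ht _ (Ideal.pow_mem_pow hx t)
    clear hi
    induction t with
    | zero => simpa using ht
    | succ t iht =>
      refine iht (hinj ?_)
      rw [LC.map_lsmul, map_zero, ← mul_smul, ← pow_succ', ht]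

/-- The base case over a Cohen-Macaulay local ring. -/
lemma killedOutside_localCohomology_quotient [IsLocalRing R] {D : ℕ}
    (hD : DepthGE (maximalIdeal R) D R) (hdim : ringKrullDim R = D) [hp : p.IsPrime]
    {J : Ideal R} (hJ : J ≠ ⊤) {i : ℕ}
    (hi : (i : WithBot ℕ∞) + ringKrullDim (R ⧸ J) < ringKrullDim (R ⧸ p)) :
    KilledOutside p (LC J i (R ⧸ p)) := by
  obtain ⟨A, _, _, _, e, hass, hmin, hdep, he⟩ := hD.exists_module (P := ⟨p, hp⟩)
    (by rw [Module.supportDim_self_eq_ringKrullDim, hdim])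
    (Module.mem_support_iff_of_finite.2 fun a ha => by
      have : a = 0 := by simpa using Module.mem_annihilator.1 ha 1
      simp [this])
  simp only at hass hmin he
  obtain ⟨k, hk, hle⟩ := hdep.exists_ideal hJ
  have hik : i < k := by
    by_contra! hki
    rw [he] at hi
    refine (hle.trans ?_).not_gt hi
    gcongr
  obtain ⟨-, x, hx⟩ := isAssociatedPrime_iff.1 hass
  have hker : LinearMap.ker (LinearMap.toSpanSingleton R A x) = p := by
    rw [hx]
    ext
    simp [Submodule.mem_colon_singleton]
  let f : (R ⧸ p) →ₗ[R] A := Submodule.liftQ p (LinearMap.toSpanSingleton R A x) hker.ge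
  have hf : Function.Injective f := by
    rw [← LinearMap.ker_eq_bot]
    exact Submodule.ker_liftQ_eq_bot _ _ _ hker.le
  clear hi
  induction i with
  | zero =>
    refine .of_forall_eq_zero fun h => LC.map_zero_injective (I := J) hf ?_
    rw [map_zero]
    exact LC.eq_zero_of_depthGE hk hik _
  | succ i ih =>
    obtain ⟨δ, -, h2⟩ := LC.exists_connecting hf (LinearMap.exact_map_mkQ_range f)
      (Submodule.mkQ_surjective _) J i
    exact .of_surjective (LC.connecting_surjective h2 fun h => LC.eq_zero_of_depthGE hk hik h)
      ((ih (by omega)).localCohomology_of_minimal _ fun q hq =>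
        hmin q (Module.support_subset_of_surjective _ (Submodule.mkQ_surjective _) hq))

end Killed

section Transfer

open IsLocalRing

lemma ringKrullDim_quotient_comap {T R : Type u} [CommRing T] [CommRing R] {g : T →+* R}
    (hg : Function.Surjective g) (J : Ideal R) :
    ringKrullDim (T ⧸ J.comap g) = ringKrullDim (R ⧸ J) := by
  have hs : Function.Surjective ((Ideal.Quotient.mk J).comp g) :=
    Ideal.Quotient.mk_surjective.comp hg
  have hk : RingHom.ker ((Ideal.Quotient.mk J).comp g) = J.comap g := by
    rw [← RingHom.comap_ker, Ideal.mk_ker]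
  rw [← hk]
  exact ringKrullDim_eq_of_ringEquiv (RingHom.quotientKerEquivOfSurjective hs)

variable {T R : Type u} [CommRing T] [CommRing R] [IsNoetherianRing T]
  [IsLocalRing T] {D : ℕ} (hD : DepthGE (maximalIdeal T) D T) (hdim : ringKrullDim T = D)
  {g : T →+* R} (hg : Function.Surjective g)
include hD hdim hg

lemma killedOutside_localCohomology_quotient_of_surjective [IsNoetherianRing R]
    {I p : Ideal R} [hp : p.IsPrime] (hI : I ⊔ p ≠ ⊤) {i : ℕ}
    (hi : (i : WithBot ℕ∞) + ringKrullDim (R ⧸ I ⊔ p) < ringKrullDim (R ⧸ p)) :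
    KilledOutside p (LC I i (R ⧸ p)) := by
  let _ : Algebra T R := g.toAlgebra
  have hTp : ∀ t : T, algebraMap T (R ⧸ p) t = Ideal.Quotient.mk p (g t) := fun t => rfl
  have hsurj : Function.Surjective (algebraMap T (R ⧸ p)) :=
    Ideal.Quotient.mk_surjective.comp hg
  have hsurj' : Function.Surjective (algebraMap R (R ⧸ p)) := Ideal.Quotient.mk_surjective
  have : Module.Finite T (R ⧸ p) :=
    Module.Finite.of_surjective (Algebra.linearMap T (R ⧸ p)) hsurj
  rw [← ringKrullDim_quotient_comap hg, ← ringKrullDim_quotient_comap hg p] at hi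
  have hann : ∀ q ∈ Module.support T (R ⧸ p), p.comap g ≤ q.asIdeal := by
    intro q hq t ht
    apply Module.mem_support_iff_of_finite.1 hq
    rw [Module.mem_annihilator]
    intro x
    have h0 : Ideal.Quotient.mk p (g t) = 0 := Ideal.Quotient.eq_zero_iff_mem.2 ht
    rw [Algebra.smul_def, hTp, h0, zero_mul]
  obtain ⟨s, hs, hsk⟩ := (killedOutside_localCohomology_quotient hD hdim
    (J := (I ⊔ p).comap g) (Ideal.comap_ne_top g hI) hi).localCohomology_of_minimal (R ⧸ p)
    fun q hq hle => le_antisymm hle (hann q hq)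
  refine ⟨g s, hs, ?_⟩
  have h1 := LC.smul_eq_zero_map hsurj ((I ⊔ p).comap g) s i (R ⧸ p) hsk
  have hmap : ((I ⊔ p).comap g).map (algebraMap T (R ⧸ p)) = I.map (algebraMap R (R ⧸ p)) := by
    have : algebraMap T (R ⧸ p) = (algebraMap R (R ⧸ p)).comp g := rfl
    rw [this, ← Ideal.map_map, Ideal.map_comap_of_surjective g hg, Ideal.map_sup,
      Ideal.Quotient.algebraMap_eq, Ideal.map_quotient_self, sup_bot_eq]
  rw [hmap] at h1
  exact LC.smul_eq_zero_of_map hsurj' I (g s) i (R ⧸ p) h1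

lemma ringKrullDim_quotient_le_succ_of_surjective
    {Q₀ Q : Ideal R} [hQ₀ : Q₀.IsPrime] [hQ : Q.IsPrime]
    (hle : Q₀ ≤ Q) {y : R} (hy : y ∈ Q)
    (hmin : ∀ Q' : Ideal R, Q'.IsPrime → Q₀ ≤ Q' → Q' ≤ Q → y ∈ Q' → Q' = Q) :
    ringKrullDim (R ⧸ Q₀) ≤ ringKrullDim (R ⧸ Q) + 1 := by
  obtain ⟨y, rfl⟩ := hg y
  rw [← ringKrullDim_quotient_comap hg, ← ringKrullDim_quotient_comap hg Q]
  refine ringKrullDim_quotient_le_succ hD hdim (Ideal.comap_mono hle) (y := y) hy ?_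
  intro Q' hQ' h0 hQ'Q hyQ'
  have hker : RingHom.ker g ≤ Q' := (Ideal.comap_mono bot_le).trans h0
  have hcm : (Q'.map g).comap g = Q' := by
    rw [Ideal.comap_map_of_surjective g hg]
    exact sup_eq_left.2 hker
  rw [← hcm, hmin (Q'.map g) (Ideal.map_isPrime_of_surjective hg hker) ?_
    (Ideal.map_le_iff_le_comap.2 hQ'Q) (Ideal.mem_map_of_mem g hyQ')]
  rw [← Ideal.map_comap_of_surjective g hg Q₀]
  exact Ideal.map_mono h0

end Transfer

section LocalDepth

open IsLocalRing
open scoped Pointwise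

variable {R : Type u} [CommRing R]

/-- The localization of `N` at `q` has depth at least `min ℓ (dim N_q)`. -/
def LocalDepthGE (q : Ideal R) [q.IsPrime] (ℓ : ℕ) (N : Type u) [AddCommGroup N] [Module R N] :
    Prop :=
  ∀ d : ℕ, d ≤ ℓ →
    (d : WithBot ℕ∞) ≤ Module.supportDim (Localization.AtPrime q)
      (LocalizedModule q.primeCompl N) →
    DepthGE (maximalIdeal (Localization.AtPrime q)) d (LocalizedModule q.primeCompl N)

variable {N : Type u} [AddCommGroup N] [Module R N]

lemma LocalizedModule.mk_eq_zero_iff {S : Submonoid R} {n : N} {s : S} :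
    LocalizedModule.mk n s = 0 ↔ ∃ u ∈ S, u • n = 0 := by
  rw [← LocalizedModule.zero_mk s, LocalizedModule.mk_eq]
  constructor
  · rintro ⟨u, hu⟩
    refine ⟨u * s, S.mul_mem u.2 s.2, ?_⟩
    rw [smul_zero, smul_zero] at hu
    rw [mul_smul]
    exact hu
  · rintro ⟨u, hu, h⟩
    refine ⟨⟨u, hu⟩, ?_⟩
    rw [smul_zero, smul_zero, smul_comm]
    exact (congrArg (s • ·) h).trans (smul_zero s)

lemma LocalizedModule.algebraMap_smul_mk (S : Submonoid R) (a : R) (n : N) (s : S) :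
    algebraMap R (Localization S) a • LocalizedModule.mk n s = LocalizedModule.mk (a • n) s := by
  rw [← Localization.mk_one_eq_algebraMap, LocalizedModule.mk_smul_mk, one_mul]

/-- Localization commutes with killing an element. -/
def LocalizedModule.quotSMulTopEquiv (S : Submonoid R) (y : R) :
    QuotSMulTop (algebraMap R (Localization S) y) (LocalizedModule S N) ≃ₗ[Localization S]
      LocalizedModule S (QuotSMulTop y N) := by
  let π := LocalizedModule.map S (Submodule.mkQ (y • (⊤ : Submodule R N)))
  have hπ : Function.Surjective π :=
    LocalizedModule.map_surjective S _ (Submodule.mkQ_surjective _)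
  have hk : (algebraMap R (Localization S) y • ⊤ :
      Submodule (Localization S) (LocalizedModule S N)) = LinearMap.ker π := by
    ext x
    rw [Submodule.mem_smul_pointwise_iff_exists, LinearMap.mem_ker]
    constructor
    · rintro ⟨x, -, rfl⟩
      induction x with
      | _ n s =>
        rw [LocalizedModule.algebraMap_smul_mk, LocalizedModule.map_mk,
          show Submodule.mkQ (y • (⊤ : Submodule R N)) (y • n) = 0 from
            (exact_lsmul_mkQ y N _).2 ⟨n, rfl⟩, LocalizedModule.zero_mk]
    · induction x with
      | _ n s =>
        rw [LocalizedModule.map_mk, LocalizedModule.mk_eq_zero_iff]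
        rintro ⟨u, hu, h⟩
        rw [← map_smul] at h
        obtain ⟨n', hn'⟩ := (exact_lsmul_mkQ y N _).1 h
        refine ⟨LocalizedModule.mk n' (⟨u, hu⟩ * s), trivial, ?_⟩
        rw [LocalizedModule.algebraMap_smul_mk, show y • n' = u • n from hn']
        exact LocalizedModule.mk_cancel_common_left ⟨u, hu⟩ s n
  exact (Submodule.quotEquivOfEq _ _ hk).trans (LinearMap.quotKerEquivOfSurjective π hπ)

lemma LocalizedModule.isSMulRegular_algebraMap {S : Submonoid R} {y s : R} (hs : s ∈ S)
    (hys : ∀ n : N, y • n = 0 → s • n = 0) :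
    IsSMulRegular (LocalizedModule S N) (algebraMap R (Localization S) y) := by
  rw [isSMulRegular_iff_right_eq_zero_of_smul]
  intro x
  induction x with
  | _ n t =>
    rw [LocalizedModule.algebraMap_smul_mk, LocalizedModule.mk_eq_zero_iff,
      LocalizedModule.mk_eq_zero_iff]
    rintro ⟨u, hu, h⟩
    exact ⟨s * u, S.mul_mem hs hu, by rw [mul_smul]; exact hys _ (by rw [smul_comm, h])⟩

lemma LocalDepthGE.quotSMulTop [IsNoetherianRing R] [Module.Finite R N] {q : Ideal R}
    [hq : q.IsPrime] {ℓ : ℕ} (h : LocalDepthGE q (ℓ + 1) N) {y s : R} (hs : s ∉ q)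
    (hys : ∀ n : N, y • n = 0 → s • n = 0) : LocalDepthGE q ℓ (QuotSMulTop y N) := by
  intro d hd hdim
  have hreg := LocalizedModule.isSMulRegular_algebraMap (S := q.primeCompl) hs hys
  rw [← Module.supportDim_eq_of_equiv (LocalizedModule.quotSMulTopEquiv q.primeCompl y)] at hdim
  by_cases hy : y ∈ q
  · have hy' := (IsLocalization.AtPrime.to_map_mem_maximal_iff (Localization.AtPrime q) q y).2 hy
    refine (DepthGE.quotSMulTop (h (d + 1) (by omega) ?_) hy' hreg).congr
      (LocalizedModule.quotSMulTopEquiv q.primeCompl y)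
    rw [← Module.supportDim_quotSMulTop_succ_eq_supportDim hreg hy']
    push_cast
    gcongr
  · have : Subsingleton (LocalizedModule q.primeCompl (QuotSMulTop y N)) := by
      have := Module.notMem_support_iff (R := R) (M := QuotSMulTop y N) (p := ⟨q, hq⟩)
      apply this.1
      rw [Module.support_quotSMulTop]
      exact fun h => hy (by simpa using h.2)
    exact DepthGE.of_subsingleton _ _ _

lemma exists_isSMulRegular_of_localDepthGE [IsNoetherianRing R] [Module.Finite R N] {p : Ideal R}
    [hp : p.IsPrime] {ℓ : ℕ} (h : LocalDepthGE p (ℓ + 1) N)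
    {q : PrimeSpectrum R} (hq : q ∈ Module.support R N) (hqp : q.asIdeal < p) :
    ∃ y ∈ p, ∃ s ∉ p, ∀ n : N, y • n = 0 → s • n = 0 := by
  have hsupp : ∀ q ∈ Module.support R N, q.asIdeal ≤ p →
      ∃ Q ∈ Module.support (Localization.AtPrime p) (LocalizedModule p.primeCompl N),
        Q.asIdeal.comap (algebraMap R (Localization.AtPrime p)) = q.asIdeal := by
    intro q hq hqp
    have hdisj : Disjoint (p.primeCompl : Set R) q.asIdeal :=
      Set.disjoint_left.2 fun a ha haq => ha (hqp haq)
    refine ⟨⟨q.asIdeal.map (algebraMap R (Localization.AtPrime p)),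
      IsLocalization.isPrime_of_isPrime_disjoint p.primeCompl _ _ q.2 hdisj⟩, ?_,
      IsLocalization.under_map_of_isPrime_disjoint p.primeCompl _ q.2 hdisj⟩
    rw [Module.mem_support_iff_exists_annihilator] at hq ⊢
    obtain ⟨n, hn⟩ := hq
    refine ⟨LocalizedModule.mk n 1, fun x hx => ?_⟩
    rw [Submodule.mem_annihilator_span_singleton] at hx
    obtain ⟨a, t, rfl⟩ := IsLocalization.exists_mk'_eq p.primeCompl x
    rw [IsLocalization.mk'_mem_iff]
    rw [← Localization.mk_eq_mk', LocalizedModule.mk_smul_mk,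
      LocalizedModule.mk_eq_zero_iff] at hx
    obtain ⟨u, hu, hua⟩ := hx
    refine Ideal.mem_map_of_mem _ ((q.2.mem_or_mem (x := u) (y := a) (hn ?_)).resolve_left
      fun h => hu (hqp h))
    rw [Submodule.mem_annihilator_span_singleton, mul_smul, hua]
  obtain ⟨Q, hQ, hQq⟩ := hsupp q hq hqp.le
  obtain ⟨P, hP, hPp⟩ := hsupp ⟨p, hp⟩ (Module.mem_support_mono hqp.le hq) le_rfl
  have hne : Q ≠ P := by
    rintro rfl
    exact hqp.ne (hQq.symm.trans hPp)
  have hPmax : P.asIdeal = maximalIdeal _ := by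
    refine le_antisymm (le_maximalIdeal P.2.ne_top) fun x hx => ?_
    obtain ⟨a, t, rfl⟩ := IsLocalization.exists_mk'_eq p.primeCompl x
    rw [IsLocalization.mk'_mem_iff] at hx ⊢
    rw [IsLocalization.AtPrime.to_map_mem_maximal_iff (Localization.AtPrime p) p] at hx
    exact hPp.ge hx
  have hlt : Q < P := lt_of_le_of_ne (by
    rw [← PrimeSpectrum.asIdeal_le_asIdeal, hPmax]
    exact le_maximalIdeal Q.2.ne_top) hne
  have hpos : 0 < Module.supportDim (Localization.AtPrime p) (LocalizedModule p.primeCompl N) :=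
    Order.krullDim_pos_iff.2 ⟨⟨Q, hQ⟩, ⟨P, hP⟩, hlt⟩
  obtain ⟨x, hx, hreg, -⟩ := depthGE_succ_iff.1 (h (0 + 1) (by omega) (by
    exact_mod_cast ENat.WithBot.add_one_le_iff.2 (by exact_mod_cast hpos)))
  obtain ⟨y, t, rfl⟩ := IsLocalization.exists_mk'_eq p.primeCompl x
  rw [IsLocalization.mk'_mem_iff,
    IsLocalization.AtPrime.to_map_mem_maximal_iff (Localization.AtPrime p) p] at hx
  obtain ⟨s, hs, hsk⟩ := killedOutside_of_notMem_support (p := p)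
    (X := LinearMap.ker (LinearMap.lsmul R N y)) (by
      rw [Module.notMem_support_iff, LocalizedModule.subsingleton_iff]
      rintro ⟨n, hn⟩
      have h0 : LocalizedModule.mk n (1 : p.primeCompl) = 0 := by
        refine (isSMulRegular_iff_right_eq_zero_of_smul).1 hreg _ ?_
        rw [← Localization.mk_eq_mk', LocalizedModule.mk_smul_mk, show y • n = 0 from hn,
          LocalizedModule.zero_mk]
      obtain ⟨u, hu, h⟩ := LocalizedModule.mk_eq_zero_iff.1 h0
      exact ⟨u, hu, Subtype.ext h⟩)
  exact ⟨y, hx, s, hs, fun n hn => congrArg Subtype.val (hsk ⟨n, hn⟩)⟩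

end LocalDepth

section Vanishing

open IsLocalRing
open scoped Pointwise

variable {R : Type u} [CommRing R] {N : Type u} [AddCommGroup N] [Module R N]

lemma exists_smul_eq_zero_of_killedOutside (I p : Ideal R) [hp : p.IsPrime] {y s : R}
    (hs : s ∉ p) (hys : ∀ n : N, y • n = 0 → s • n = 0) (i : ℕ)
    (hQ : ∀ j, i = j + 1 → KilledOutside p (LC I j (QuotSMulTop y N))) :
    ∃ t ∉ p, ∀ x : LC I i N, y • x = 0 → t • x = 0 := by
  let φ := LinearMap.lsmul R N y
  obtain ⟨a, ha, hak⟩ : KilledOutside p (LC I i (LinearMap.ker φ)) :=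
    KilledOutside.localCohomology ⟨s, hs, fun n => Subtype.ext (hys n n.2)⟩ I i
  have hker := LC.map_exact (LinearMap.ker φ).injective_subtype
    (f := (LinearMap.ker φ).subtype) (g := φ.rangeRestrict)
    (LinearMap.exact_iff.2 (by simp)) φ.surjective_rangeRestrict I i
  have hrange : ∃ b ∉ p, ∀ x : LC I i (LinearMap.range φ),
      LC.map I i (LinearMap.range φ).subtype x = 0 → b • x = 0 := by
    rcases i with _ | j
    · refine ⟨1, (Ideal.ne_top_iff_one p).1 hp.ne_top, fun x hx => ?_⟩
      rw [LC.map_zero_injective (LinearMap.range φ).injective_subtype (hx.trans (map_zero _).symm),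
        smul_zero]
    · obtain ⟨b, hb, hbk⟩ := hQ j rfl
      obtain ⟨δ, -, h2⟩ := LC.exists_connecting (LinearMap.range φ).injective_subtype
        (f := (LinearMap.range φ).subtype) (g := Submodule.mkQ (y • (⊤ : Submodule R N)))
        (fun n => by
          rw [exact_lsmul_mkQ y N n]
          simp [φ]) (Submodule.mkQ_surjective _) I j
      refine ⟨b, hb, fun x hx => ?_⟩
      obtain ⟨z, rfl⟩ := (h2 x).1 hx
      rw [← map_smul, hbk z, map_zero]
  obtain ⟨b, hb, hbk⟩ := hrange
  refine ⟨a * b, fun h => (hp.mem_or_mem h).elim ha hb, fun x hx => ?_⟩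
  have hφ : (LinearMap.range φ).subtype ∘ₗ φ.rangeRestrict = φ :=
    LinearMap.subtype_comp_codRestrict _ _ _
  have h1 : LC.map I i (LinearMap.range φ).subtype (LC.map I i φ.rangeRestrict x) = 0 := by
    rw [← LinearMap.comp_apply, ← LC.map_comp, hφ]
    exact (LC.map_lsmul y x).trans hx
  obtain ⟨z, hz⟩ := (hker (b • x)).1 (by rw [map_smul, hbk _ h1])
  rw [mul_smul, ← hz, ← map_smul, hak, map_zero]

/-- If every smaller prime fails to contain the annihilator of `X`, and `X` has no new
`y`-torsion at `p`, then `X` vanishes at `p`. -/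
lemma KilledOutside.of_forall_lt {p : PrimeSpectrum R} {X : Type u} [AddCommGroup X] [Module R X]
    (h : ∀ q < p, KilledOutside q.asIdeal X) {y t : R} (hy : y ∈ p.asIdeal) (ht : t ∉ p.asIdeal)
    (hyt : ∀ x : X, y • x = 0 → t • x = 0) : KilledOutside p.asIdeal X := by
  by_cases hdisj : Disjoint (Module.annihilator R X : Set R)
      (p.asIdeal.primeCompl ⊔ Submonoid.powers y : Submonoid R)
  · obtain ⟨q, hq, hXq, hqS⟩ := Ideal.exists_le_prime_disjoint _ _ hdisj
    have hqp : q ≤ p.asIdeal := by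
      intro a ha
      by_contra hap
      exact Set.disjoint_left.1 hqS ha (Submonoid.mem_sup_left (S := p.asIdeal.primeCompl) hap)
    have hyq : y ∉ q := fun h =>
      Set.disjoint_left.1 hqS h (Submonoid.mem_sup_right (Submonoid.mem_powers y))
    obtain ⟨s, hs, hsX⟩ := h ⟨q, hq⟩ (lt_of_le_not_ge hqp fun h => hyq (h hy))
    exact absurd (hXq (Module.mem_annihilator.2 hsX)) hs
  · obtain ⟨a, haX, ha⟩ := Set.not_disjoint_iff.1 hdisj
    obtain ⟨s, hs, z, hz, rfl⟩ := Submonoid.mem_sup.1 ha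
    obtain ⟨k, rfl⟩ := hz
    have hpow : ∀ (k : ℕ) (x : X), y ^ k • x = 0 → t ^ k • x = 0 := by
      intro k
      induction k with
      | zero => exact fun x => by simp
      | succ k ih =>
        intro x hx
        rw [pow_succ, mul_smul] at hx ⊢
        have := ih _ hx
        rw [smul_comm] at this
        rw [smul_comm]
        exact hyt _ this
    refine ⟨t ^ k * s, fun h => (p.2.mem_or_mem h).elim (fun h => ht (p.2.mem_of_pow_mem k h)) hs,
      fun x => ?_⟩
    rw [mul_smul]
    apply hpow
    rw [← mul_smul, mul_comm]
    exact Module.mem_annihilator.1 haX x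

variable [IsNoetherianRing R] [IsLocalRing R]

theorem killedOutside_localCohomology_of_localDepthGE {I : Ideal R} (hI : I ≠ ⊤) {r : ℕ}
    (HB : ∀ (p : PrimeSpectrum R) (i : ℕ), I ⊔ p.asIdeal ≠ ⊤ →
      (i : WithBot ℕ∞) + ringKrullDim (R ⧸ I ⊔ p.asIdeal) < ringKrullDim (R ⧸ p.asIdeal) →
      KilledOutside p.asIdeal (LC I i (R ⧸ p.asIdeal)))
    (HC : ∀ (Q₀ Q : PrimeSpectrum R) (y : R), Q₀ ≤ Q → y ∈ Q.asIdeal →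
      (∀ Q' : PrimeSpectrum R, Q₀ ≤ Q' → Q' ≤ Q → y ∈ Q'.asIdeal → Q' = Q) →
      ringKrullDim (R ⧸ Q₀.asIdeal) ≤ ringKrullDim (R ⧸ Q.asIdeal) + 1)
    (ℓ : ℕ) (N : Type u) [AddCommGroup N] [Module R N] [Module.Finite R N]
    (p : PrimeSpectrum R) (hIp : ¬ I ≤ p.asIdeal)
    (hdepth : ∀ q ≤ p, LocalDepthGE q.asIdeal ℓ N)
    (hdim : ∀ q ∈ Module.support R N, q ≤ p → (∀ q' ∈ Module.support R N, q' ≤ q → q' = q) →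
      (r + ℓ + 1 : ℕ) ≤ ringKrullDim (R ⧸ q.asIdeal))
    (hr : ∀ q ∈ Module.support R N, q ≤ p → ringKrullDim (R ⧸ I ⊔ q.asIdeal) ≤ r)
    {i : ℕ} (hi : i ≤ ℓ) : KilledOutside p.asIdeal (LC I i N) := by
  induction ℓ generalizing N p i with
  | zero =>
    obtain rfl : i = 0 := by omega
    obtain ⟨t, ht⟩ := exists_pow_smul_eq_zero_of_finite (I := I) (X := powTorsion I N)
      fun x => by
        obtain ⟨t, ht⟩ := mem_powTorsion.1 x.2
        exact ⟨t, fun a ha => Subtype.ext (ht a ha)⟩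
    obtain ⟨s, hs, hsp⟩ := SetLike.not_le_iff_exists.1 fun h => hIp (p.2.le_of_pow_le h)
    exact .of_surjective (LC.torsionEquiv I N).surjective ⟨s, hsp, fun x => ht x s hs⟩
  | succ ℓ ih =>
    have hlt : WellFounded ((· < ·) : PrimeSpectrum R → PrimeSpectrum R → Prop) :=
      Subrelation.wf (r := InvImage (· < ·) fun q : PrimeSpectrum R => q.asIdeal.height)
        (fun h => Ideal.height_strict_mono_of_isPrime h) (InvImage.wf _ wellFounded_lt)
    induction p using hlt.induction generalizing i with
    | _ p ihp =>
    by_cases hp : p ∈ Module.support R N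
    swap
    · exact (killedOutside_of_notMem_support hp).localCohomology I i
    by_cases hmin : ∀ q ∈ Module.support R N, q ≤ p → q = p
    · refine KilledOutside.localCohomology_of_minimal (HB p i ?_ ?_) N
        fun q hq hqp => by rw [hmin q hq hqp]
      · exact ne_top_of_le_ne_top (maximalIdeal.isMaximal R).ne_top
          (sup_le (le_maximalIdeal hI) (le_maximalIdeal p.2.ne_top))
      · calc (i : WithBot ℕ∞) + ringKrullDim (R ⧸ I ⊔ p.asIdeal)
            ≤ ((ℓ + 1 : ℕ) : WithBot ℕ∞) + r := by
              gcongr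
              exact hr p hp le_rfl
          _ < (r + (ℓ + 1) + 1 : ℕ) := by
              norm_cast
              omega
          _ ≤ _ := hdim p hp le_rfl hmin
    · push Not at hmin
      obtain ⟨q, hq, hqp, hne⟩ := hmin
      obtain ⟨y, hy, s, hs, hys⟩ := exists_isSMulRegular_of_localDepthGE (hdepth p le_rfl) hq
        (PrimeSpectrum.asIdeal_lt_asIdeal q p |>.2 (lt_of_le_of_ne hqp hne))
      have hsupp := Module.support_quotSMulTop (R := R) (M := N) y
      have hQ : ∀ j ≤ ℓ, KilledOutside p.asIdeal (LC I j (QuotSMulTop y N)) := by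
        intro j hj
        refine ih (QuotSMulTop y N) p hIp (fun q hq => (hdepth q hq).quotSMulTop
          (fun h => hs (hq h)) hys) ?_ ?_ hj
        · intro q hq hqp hqmin
          rw [hsupp] at hq
          obtain ⟨hqN, hyq⟩ := hq
          obtain ⟨q₀, hq₀, hq₀q⟩ := Ideal.exists_minimalPrimes_le
            (Module.mem_support_iff_of_finite.1 hqN)
          let Q₀ : PrimeSpectrum R := ⟨q₀, hq₀.1.1⟩
          have hQ₀ : Q₀ ∈ Module.support R N := Module.mem_support_iff_of_finite.2 hq₀.1.2
          have h1 := hdim Q₀ hQ₀ (le_trans hq₀q hqp) fun q' hq' hle =>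
            le_antisymm hle (hq₀.2 ⟨q'.2, Module.mem_support_iff_of_finite.1 hq'⟩ hle)
          have h2 := h1.trans (HC Q₀ q y hq₀q (by simpa using hyq) fun Q' h0 hQ'q hyQ' =>
            hqmin Q' (hsupp ▸ ⟨Module.mem_support_mono h0 hQ₀, by simpa using hyQ'⟩) hQ'q)
          rw [← ENat.WithBot.add_le_add_one_right_iff]
          refine le_trans (le_of_eq ?_) h2
          norm_cast
        · intro q hq hqp
          rw [hsupp] at hq
          exact hr q hq.1 hqp
      obtain ⟨t, ht, hyt⟩ := exists_smul_eq_zero_of_killedOutside I p.asIdeal hs hys i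
        fun j hj => hQ j (by omega)
      refine KilledOutside.of_forall_lt (fun q hq => ihp q hq (fun h => hIp (h.trans hq.le))
        (fun q' hq' => hdepth q' (hq'.trans hq.le)) (fun q' h hq' => hdim q' h (hq'.trans hq.le))
        (fun q' h hq' => hr q' h (hq'.trans hq.le)) hi) hy ht hyt

end Vanishing

section SerreDepth

open IsLocalRing

lemma DepthGE.of_le_moduleDepth {S : Type u} [CommRing S] {J : Ideal S} {d : ℕ} {N : Type u}
    [AddCommGroup N] [Module S N] (h : (d : ℕ∞) ≤ moduleDepth S J N) : DepthGE J d N := by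
  rcases d with _ | d
  · exact .zero J N
  have hlt : (d : ℕ∞) < moduleDepth S J N :=
    lt_of_lt_of_le (by exact_mod_cast Nat.lt_succ_self d) h
  obtain ⟨_, ⟨rs, rfl, hrs, hreg⟩, hd⟩ := lt_sSup_iff.1 hlt
  exact DepthGE.mono (by exact_mod_cast hd) ⟨rs, rfl, hrs, hreg.toIsWeaklyRegular⟩

lemma SerreCondition.localDepthGE {R : Type u} [CommRing R] [IsNoetherianRing R] {ℓ : ℕ}
    {M : Type u} [AddCommGroup M] [Module R M] [Module.Finite R M] (h : SerreCondition R ℓ M)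
    (q : PrimeSpectrum R) : LocalDepthGE q.asIdeal ℓ M := by
  intro d hd hdim
  by_cases hq : q ∈ Module.support R M
  · rw [Module.supportDim_eq_ringKrullDim_quotient_annihilator] at hdim
    refine DepthGE.of_le_moduleDepth (WithBot.coe_le_coe.1 (le_trans (le_min ?_ hdim) (h q hq)))
    exact_mod_cast hd
  · have := Module.notMem_support_iff.1 hq
    exact .of_subsingleton _ _ _

lemma exists_surjective_of_isCMRing {R S : Type u} [CommRing R] [IsLocalRing R] [CommRing S]
    [IsNoetherianRing S] (hCM : IsCMRing S) {f : S →+* R} (hf : Function.Surjective f) :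
    ∃ (T : Type u) (_ : CommRing T) (_ : IsNoetherianRing T) (_ : IsLocalRing T) (D : ℕ)
      (g : T →+* R), DepthGE (maximalIdeal T) D T ∧ ringKrullDim T = D ∧ Function.Surjective g := by
  let Q : PrimeSpectrum S := PrimeSpectrum.comap f ⟨maximalIdeal R, inferInstance⟩
  have hunit : ∀ s : Q.asIdeal.primeCompl, IsUnit (f s) := fun s => by
    by_contra hs
    exact s.2 ((mem_maximalIdeal _).2 hs)
  let T := Localization.AtPrime Q.asIdeal
  obtain ⟨D, hD⟩ : ∃ D : ℕ, ringKrullDim T = D := by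
    obtain ⟨D, hD⟩ := exists_natCast_eq_ringKrullDim_quotient (S := T) (J := ⊥) bot_ne_top
    exact ⟨D, (ringKrullDim_eq_of_ringEquiv (RingEquiv.quotientBot T)).symm.trans hD⟩
  refine ⟨T, inferInstance, inferInstance, inferInstance, D, IsLocalization.lift hunit,
    DepthGE.of_le_moduleDepth (WithBot.coe_le_coe.1 ?_), hD, fun x => ?_⟩
  · have := hCM Q
    unfold IsCMLocalRing at this
    exact (hD.symm.trans this.symm).le
  · obtain ⟨s, rfl⟩ := hf x
    exact ⟨algebraMap S T s, IsLocalization.lift_eq hunit s⟩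

end SerreDepth

theorem stmt8 (R : Type u) [CommRing R] [IsNoetherianRing R] [IsLocalRing R]
    (S : Type u) [CommRing S] [IsNoetherianRing S] (hCM : IsCMRing S)
    (f : S →+* R) (hf : Function.Surjective f)
    (I : Ideal R) (M : Type u) [AddCommGroup M] [Module R M] [Module.Finite R M]
    (n r ℓ : ℕ) (hn : moduleDim R M = n)
    (hr : moduleDim R (M ⧸ (I • ⊤ : Submodule R M)) = r)
    (hequi : Equidimensional R M) (hS : SerreCondition R ℓ M)
    (hℓ : (ℓ : ℤ) ≤ (n : ℤ) - r - 1) :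
    ∀ i : ℕ, i < ℓ + 1 →
      Module.Finite R ((localCohomology I i).obj (ModuleCat.of R M)) := by
  have hI : I ≠ ⊤ := by
    rintro rfl
    have : Subsingleton (M ⧸ ((⊤ : Ideal R) • ⊤ : Submodule R M)) := by
      rw [Submodule.top_smul]
      infer_instance
    rw [moduleDim, ← Module.supportDim_eq_ringKrullDim_quotient_annihilator,
      Module.supportDim_eq_bot_of_subsingleton] at hr
    exact WithBot.bot_ne_coe hr
  obtain ⟨T, _, _, _, D, g, hD, hdim, hg⟩ := exists_surjective_of_isCMRing hCM hf
  have hn' : moduleDim R M = ((n : ℕ) : WithBot ℕ∞) := hn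
  have hr' : Module.supportDim R (M ⧸ (I • ⊤ : Submodule R M)) = ((r : ℕ) : WithBot ℕ∞) :=
    (Module.supportDim_eq_ringKrullDim_quotient_annihilator R _).trans hr
  intro i hi
  refine LC.finite_of_pow_smul_eq_zero i M fun j hj => ?_
  have hkill : ∀ p : PrimeSpectrum R, ¬ I ≤ p.asIdeal → KilledOutside p.asIdeal (LC I j M) := by
    intro p hp
    refine killedOutside_localCohomology_of_localDepthGE hI (r := r)
      (fun p i hIp h => killedOutside_localCohomology_quotient_of_surjective hD hdim hg hIp h)
      (fun Q₀ Q y hle hy hmin => ringKrullDim_quotient_le_succ_of_surjective hD hdim hg hle hy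
        fun Q' hQ' h0 hle hy => congrArg PrimeSpectrum.asIdeal (hmin ⟨Q', hQ'⟩ h0 hle hy))
      ℓ M p hp (fun q _ => hS.localDepthGE q) ?_ ?_ (by omega)
    · intro q hq _ hmin
      rw [hequi q.asIdeal ⟨⟨q.2, Module.mem_support_iff_of_finite.1 hq⟩, fun q' hq' hle =>
        (congrArg PrimeSpectrum.asIdeal
          (hmin ⟨q', hq'.1⟩ (Module.mem_support_iff_of_finite.2 hq'.2) hle)).ge⟩, hn']
      have : r + ℓ + 1 ≤ n := by omega
      exact_mod_cast this
    · intro q hq _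
      rw [← hr', ringKrullDim_quotient]
      refine Order.krullDim_le_of_strictMono (fun P => ⟨P.1, ?_⟩) fun _ _ h => h
      rw [Module.support_quotient]
      have hP : I ⊔ q.asIdeal ≤ P.1.asIdeal := P.2
      exact ⟨Module.mem_support_mono (le_sup_right.trans hP) hq, le_sup_left.trans hP⟩
  obtain ⟨k, hk⟩ := Ideal.exists_pow_le_of_le_radical_of_fg (I := I)
    (J := Module.annihilator R (LC I j M)) (by
      rw [Ideal.radical_eq_sInf]
      refine le_sInf fun p hp => ?_
      by_contra hIp
      obtain ⟨s, hs, hsX⟩ := hkill ⟨p, hp.2⟩ hIp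
      exact hs (hp.1 (Module.mem_annihilator.2 hsX))) (IsNoetherian.noetherian I)
  exact ⟨k, fun a ha => Module.mem_annihilator.1 (hk ha)⟩
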